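/- arXiv:math/0203177 — 4 statements merged into one kernel-verified Lean document; each statement's English description precedes it below -/
import Mathlib

section
/- Discrete Pitman theorem: let (ε_m)_{m≥1} be i.i.d. random variables with P(ε_m=1)=q and P(ε_m=−1)=1−q, where 1/2<q<1, let Z(n)=ε_1+⋯+ε_n (Z(0)=0) and S(n)=max_{0≤m≤n}Z(m). Then P(Z(j)≥0 for all j≥0)>0, and for every n∈ℕ and every sequence z(0)=0, z(1),…,z(n) of integers with z(m)−z(m−1)∈{−1,1} for 1≤m≤n, one has P(2S(m)−Z(m)=z(m) for all m≤n)·P(Z(j)≥0 for all j≥0) = P(Z(m)=z(m) for all m≤n, and Z(j)≥0 for all j≥0). That is, the process 2S−Z has the same law as Z conditioned to stay non-negative forever. -/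
open MeasureTheory ProbabilityTheory

namespace PitmanAux

/-- sigma-algebra generated by the steps with index in `T`. -/
def sg {Ω : Type*} (ε : ℕ → Ω → ℤ) (T : Set ℕ) : MeasurableSpace Ω :=
  ⨆ i ∈ T, MeasurableSpace.comap (ε i) ⊤

lemma meas_sg {Ω : Type*} (ε : ℕ → Ω → ℤ) (T : Set ℕ) (i : ℕ) (hi : i ∈ T) :
    Measurable[sg ε T] (ε i) := by
  have h1 : MeasurableSpace.comap (ε i) ⊤ ≤ sg ε T :=
    le_iSup₂ (f := fun i (_ : i ∈ T) => MeasurableSpace.comap (ε i) ⊤) i hi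
  exact Measurable.mono (comap_measurable (ε i)) h1 le_rfl

lemma pf {Ω : Type*} [MeasurableSpace Ω] (μ : Measure Ω)
    (ε : ℕ → Ω → ℤ) (hmeas : ∀ m, Measurable (ε m))
    (hindep : iIndepFun ε μ) (n : ℕ) (A B : Set Ω)
    (hA : MeasurableSet[sg ε {i | i < n}] A) (hB : MeasurableSet[sg ε {i | n ≤ i}] B) :
    μ.real (A ∩ B) = μ.real A * μ.real B := by
  have h : Indep (sg ε {i | i < n}) (sg ε {i | n ≤ i}) μ := by
    refine indep_iSup_of_disjoint (fun i => (hmeas i).comap_le) hindep ?_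
    rw [Set.disjoint_left]
    intro a ha hb
    simp only [Set.mem_setOf_eq] at ha hb
    omega
  rw [Indep_iff] at h
  rw [measureReal_def, h A B hA hB, ENNReal.toReal_mul]; rfl

lemma ident {Ω : Type*} [MeasurableSpace Ω] (μ : Measure Ω) [IsProbabilityMeasure μ]
    (q : ℝ) (hq : 1/2 < q) (hq1 : q < 1)
    (ε : ℕ → Ω → ℤ) (hmeas : ∀ m, Measurable (ε m))
    (hup : ∀ m, μ {ω | ε m ω = 1} = ENNReal.ofReal q)
    (hdown : ∀ m, μ {ω | ε m ω = -1} = ENNReal.ofReal (1 - q)) (m : ℕ) :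
    ∀ᵐ ω ∂μ, ε m ω = 1 ∨ ε m ω = -1 := by
  have h1 : MeasurableSet {ω | ε m ω = 1} := hmeas m (measurableSet_singleton 1)
  have h2 : MeasurableSet {ω | ε m ω = -1} := hmeas m (measurableSet_singleton (-1))
  have h : μ ({ω | ε m ω = 1} ∪ {ω | ε m ω = -1}) = 1 := by
    rw [measure_union _ h2, hup, hdown, ← ENNReal.ofReal_add (by linarith) (by linarith)]
    · simp
    · rw [Set.disjoint_left]
      intro a ha hb
      simp only [Set.mem_setOf_eq] at ha hb
      omega
  have := (prob_compl_eq_zero_iff (h1.union h2)).2 h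
  exact this

lemma law {Ω : Type*} [MeasurableSpace Ω] (μ : Measure Ω) [IsProbabilityMeasure μ]
    (q : ℝ) (hq : 1/2 < q) (hq1 : q < 1)
    (ε : ℕ → Ω → ℤ) (hmeas : ∀ m, Measurable (ε m))
    (hup : ∀ m, μ {ω | ε m ω = 1} = ENNReal.ofReal q)
    (hdown : ∀ m, μ {ω | ε m ω = -1} = ENNReal.ofReal (1 - q)) (m : ℕ) :
    μ.map (ε m) = μ.map (ε 0) := by
  apply Measure.ext_of_singleton
  intro a
  rw [Measure.map_apply (hmeas m) (measurableSet_singleton a),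
    Measure.map_apply (hmeas 0) (measurableSet_singleton a)]
  by_cases ha : a = 1
  · subst ha; exact (hup m).trans (hup 0).symm
  by_cases hb : a = -1
  · subst hb; exact (hdown m).trans (hdown 0).symm
  have key : ∀ k, μ (ε k ⁻¹' {a}) = 0 := by
    intro k
    have := ident μ q hq hq1 ε hmeas hup hdown k
    refine measure_mono_null ?_ this
    intro ω hω
    simp only [Set.mem_preimage, Set.mem_singleton_iff] at hω
    simp only [Set.mem_compl_iff, Set.mem_setOf_eq]
    omega
  rw [key, key]

/-- The event that the walk made of the steps from index `n`, started at `k`, stays nonnegative. -/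
def stay {Ω : Type*} (ε : ℕ → Ω → ℤ) (n : ℕ) (k : ℤ) : Set Ω :=
  {ω | ∀ j, 0 ≤ k + ∑ i ∈ Finset.range j, ε (n + i) ω}

lemma stay_shift {Ω : Type*} [MeasurableSpace Ω] (μ : Measure Ω) [IsProbabilityMeasure μ]
    (q : ℝ) (hq : 1/2 < q) (hq1 : q < 1)
    (ε : ℕ → Ω → ℤ) (hmeas : ∀ m, Measurable (ε m))
    (hindep : iIndepFun ε μ)
    (hup : ∀ m, μ {ω | ε m ω = 1} = ENNReal.ofReal q)
    (hdown : ∀ m, μ {ω | ε m ω = -1} = ENNReal.ofReal (1 - q)) (n : ℕ) (k : ℤ) :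
    μ.real (stay ε n k) = μ.real (stay ε 0 k) := by
  have hlaw : ∀ n, μ.map (fun ω (i : ℕ) => ε (n + i) ω)
      = Measure.infinitePi (fun _ : ℕ => μ.map (ε 0)) := by
    intro n
    have h1 : iIndepFun (fun i => ε (n + i)) μ :=
      hindep.precomp (g := fun i => n + i) (fun a b h => by simpa using h)
    rw [h1.map_fun_eq_infinitePi_map (fun i => hmeas _)]
    congr 1
    funext i
    exact law μ q hq hq1 ε hmeas hup hdown (n + i)
  have hset : MeasurableSet {f : ℕ → ℤ | ∀ j, 0 ≤ k + ∑ i ∈ Finset.range j, f i} := by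
    rw [Set.setOf_forall]
    refine MeasurableSet.iInter fun j => ?_
    exact measurableSet_le measurable_const (by fun_prop)
  have hm : ∀ n, Measurable (fun ω (i : ℕ) => ε (n + i) ω) := fun n =>
    measurable_pi_iff.2 fun i => hmeas _
  have : ∀ n, μ (stay ε n k) = Measure.infinitePi (fun _ : ℕ => μ.map (ε 0))
      {f : ℕ → ℤ | ∀ j, 0 ≤ k + ∑ i ∈ Finset.range j, f i} := by
    intro n
    rw [← hlaw n, Measure.map_apply (hm n) hset]
    rfl
  rw [measureReal_def, measureReal_def, this n, this 0]

lemma stay_meas {Ω : Type*} (ε : ℕ → Ω → ℤ) (n : ℕ) (k : ℤ) :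
    MeasurableSet[sg ε {i | n ≤ i}] (stay ε n k) := by
  unfold stay
  rw [Set.setOf_forall]
  refine MeasurableSet.iInter fun j => ?_
  refine measurableSet_le measurable_const (Measurable.const_add ?_ _)
  refine Finset.measurable_fun_sum _ fun i _ => ?_
  exact meas_sg ε _ _ (by simp)

lemma stay_split {Ω : Type*} (ε : ℕ → Ω → ℤ) (n : ℕ) (k : ℤ) (hk : 0 ≤ k) (ω : Ω) :
    ω ∈ stay ε n k ↔ ω ∈ stay ε (n + 1) (k + ε n ω) := by
  unfold stay
  simp only [Set.mem_setOf_eq]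
  have e : ∀ j, ∑ i ∈ Finset.range (j + 1), ε (n + i) ω
      = ε n ω + ∑ i ∈ Finset.range j, ε (n + 1 + i) ω := by
    intro j
    rw [Finset.sum_range_succ', add_comm]
    simp only [add_zero]
    congr 1
    refine Finset.sum_congr rfl fun i _ => ?_
    rw [show n + (i + 1) = n + 1 + i by omega]
  constructor
  · intro h j
    have := h (j + 1)
    rw [e] at this
    linarith
  · intro h j
    cases j with
    | zero => simpa using hk
    | succ j => rw [e]; have := h j; linarith

lemma stay_rec {Ω : Type*} [MeasurableSpace Ω] (μ : Measure Ω) [IsProbabilityMeasure μ]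
    (q : ℝ) (hq : 1/2 < q) (hq1 : q < 1)
    (ε : ℕ → Ω → ℤ) (hmeas : ∀ m, Measurable (ε m))
    (hindep : iIndepFun ε μ)
    (hup : ∀ m, μ {ω | ε m ω = 1} = ENNReal.ofReal q)
    (hdown : ∀ m, μ {ω | ε m ω = -1} = ENNReal.ofReal (1 - q)) (k : ℤ) (hk : 0 ≤ k) :
    μ.real (stay ε 0 k) = q * μ.real (stay ε 0 (k + 1)) + (1 - q) * μ.real (stay ε 0 (k - 1)) := by
  have hE : ∀ a : ℤ, MeasurableSet[sg ε {i | i < 1}] {ω | ε 0 ω = a} := fun a =>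
    (meas_sg ε {i | i < 1} 0 (by simp)) (measurableSet_singleton a)
  have hle : ∀ T, sg ε T ≤ (inferInstance : MeasurableSpace Ω) := fun T =>
    iSup₂_le fun i _ => (hmeas i).comap_le
  have h1 : stay ε 0 k =ᵐ[μ] (({ω | ε 0 ω = 1} ∩ stay ε 1 (k + 1)) ∪
      ({ω | ε 0 ω = -1} ∩ stay ε 1 (k - 1)) : Set Ω) := by
    rw [Filter.eventuallyEq_set]
    filter_upwards [ident μ q hq hq1 ε hmeas hup hdown 0] with ω hω
    rw [stay_split ε 0 k hk]
    simp only [Set.mem_union, Set.mem_inter_iff, Set.mem_setOf_eq]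
    rcases hω with h | h
    · simp [h]
    · simp [h, sub_eq_add_neg]
  rw [measureReal_congr h1, measureReal_union _ ((hle _ _ (hE _)).inter (hle _ _ (stay_meas ε 1 _))),
    pf μ ε hmeas hindep 1 _ _ (hE 1) (stay_meas ε 1 _),
    pf μ ε hmeas hindep 1 _ _ (hE (-1)) (stay_meas ε 1 _),
    stay_shift μ q hq hq1 ε hmeas hindep hup hdown 1,
    stay_shift μ q hq hq1 ε hmeas hindep hup hdown 1,
    measureReal_def, hup, measureReal_def (s := {ω | ε 0 ω = -1}), hdown,
    ENNReal.toReal_ofReal (by linarith), ENNReal.toReal_ofReal (by linarith)]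
  rw [Set.disjoint_left]
  rintro a ⟨ha, _⟩ ⟨hb, _⟩
  simp only [Set.mem_setOf_eq] at ha hb
  omega

lemma stay_neg {Ω : Type*} (ε : ℕ → Ω → ℤ) (n : ℕ) (k : ℤ) (hk : k < 0) : stay ε n k = ∅ := by
  ext ω
  simp only [stay, Set.mem_setOf_eq, Set.mem_empty_iff_false, iff_false, not_forall]
  exact ⟨0, by simpa using hk⟩

lemma stay_geom {Ω : Type*} [MeasurableSpace Ω] (μ : Measure Ω) [IsProbabilityMeasure μ]
    (q : ℝ) (hq : 1/2 < q) (hq1 : q < 1)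
    (ε : ℕ → Ω → ℤ) (hmeas : ∀ m, Measurable (ε m))
    (hindep : iIndepFun ε μ)
    (hup : ∀ m, μ {ω | ε m ω = 1} = ENNReal.ofReal q)
    (hdown : ∀ m, μ {ω | ε m ω = -1} = ENNReal.ofReal (1 - q)) (k : ℕ) :
    μ.real (stay ε 0 k) * (q - (1 - q)) * q ^ k
      = μ.real (stay ε 0 0) * (q ^ (k + 1) - (1 - q) ^ (k + 1)) := by
  have R := stay_rec μ q hq hq1 ε hmeas hindep hup hdown
  suffices H : ∀ k : ℕ, μ.real (stay ε 0 k) * (q - (1 - q)) * q ^ k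
      = μ.real (stay ε 0 0) * (q ^ (k + 1) - (1 - q) ^ (k + 1)) ∧
      μ.real (stay ε 0 ((k + 1 : ℕ) : ℤ)) * (q - (1 - q)) * q ^ (k + 1)
      = μ.real (stay ε 0 0) * (q ^ (k + 2) - (1 - q) ^ (k + 2)) from (H k).1
  intro k
  induction k with
  | zero =>
    have h0 := R 0 le_rfl
    rw [stay_neg ε 0 (0 - 1) (by norm_num)] at h0
    simp only [measureReal_empty, mul_zero, add_zero, zero_add] at h0
    refine ⟨by simp, ?_⟩
    simp only [zero_add, Nat.cast_one, pow_one]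
    linear_combination (-(q - (1 - q))) * h0
  | succ k ih =>
    refine ⟨ih.2, ?_⟩
    have h0 := R ((k + 1 : ℕ) : ℤ) (by positivity)
    rw [show ((k + 1 : ℕ) : ℤ) - 1 = (k : ℤ) by push_cast; ring,
      show ((k + 1 : ℕ) : ℤ) + 1 = ((k + 1 + 1 : ℕ) : ℤ) by push_cast; ring] at h0
    obtain ⟨i1, i2⟩ := ih
    linear_combination (-(q - (1 - q)) * q ^ (k + 1)) * h0 + i2 - (1 - q) * q * i1

lemma stay_pos {Ω : Type*} [MeasurableSpace Ω] (μ : Measure Ω) [IsProbabilityMeasure μ]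
    (q : ℝ) (hq : 1/2 < q) (hq1 : q < 1)
    (ε : ℕ → Ω → ℤ) (hmeas : ∀ m, Measurable (ε m))
    (hindep : iIndepFun ε μ)
    (hup : ∀ m, μ {ω | ε m ω = 1} = ENNReal.ofReal q)
    (hdown : ∀ m, μ {ω | ε m ω = -1} = ENNReal.ofReal (1 - q)) :
    μ.real (stay ε 0 0) ≠ 0 := by
  intro h0
  have hk : ∀ k : ℕ, μ (stay ε 0 k) = 0 := by
    intro k
    have := stay_geom μ q hq hq1 ε hmeas hindep hup hdown k
    rw [h0, zero_mul] at this
    have h2 : μ.real (stay ε 0 k) = 0 := by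
      have a1 : q - (1 - q) ≠ 0 := by intro h; linarith
      have a2 : q ^ k ≠ 0 := pow_ne_zero _ (by linarith)
      simpa [a1, a2, mul_eq_zero] using this
    exact (measureReal_eq_zero_iff).1 h2
  have hae : ∀ᵐ ω ∂μ, ∃ k : ℕ, ω ∈ stay ε 0 k := by
    have hE1 : MeasurableSet {ω | ε 0 ω = 1} := hmeas 0 (measurableSet_singleton 1)
    have hid := ident μ q hq hq1 ε hmeas hup hdown 0
    have hform : (fun ω => (ε 0 ω : ℝ)) =ᵐ[μ]
        fun ω => 2 * Set.indicator {ω | ε 0 ω = 1} (fun _ => (1 : ℝ)) ω - 1 := by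
      filter_upwards [hid] with ω hω
      rcases hω with h | h <;> simp [Set.indicator, h] <;> norm_num
    have hi1 : Integrable (Set.indicator {ω | ε 0 ω = 1} (fun _ => (1 : ℝ))) μ :=
      (integrable_const 1).indicator hE1
    have hint : Integrable (fun ω => (ε 0 ω : ℝ)) μ :=
      (integrable_congr hform).2 ((hi1.const_mul 2).sub (integrable_const 1))
    have hmean : ∫ ω, (ε 0 ω : ℝ) ∂μ = 2 * q - 1 := by
      rw [integral_congr_ae hform, integral_sub (hi1.const_mul 2) (integrable_const 1),
        integral_const_mul, integral_indicator_const _ hE1, measureReal_def, hup,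
        ENNReal.toReal_ofReal (by linarith)]
      simp
    have hcast : Measurable (fun x : ℤ => (x : ℝ)) := measurable_from_top
    have sl := strong_law_ae_real (μ := μ) (fun i ω => (ε i ω : ℝ)) hint
      (fun i j hij => (hindep.indepFun hij).comp hcast hcast)
      (fun i => (IdentDistrib.mk (hmeas i).aemeasurable (hmeas 0).aemeasurable
        (law μ q hq hq1 ε hmeas hup hdown i)).comp hcast)
    rw [hmean] at sl
    filter_upwards [sl] with ω hω
    have ev := hω.eventually (lt_mem_nhds (show (0 : ℝ) < 2 * q - 1 by linarith))
    obtain ⟨N, hN⟩ := Filter.eventually_atTop.1 ev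
    refine ⟨∑ j ∈ Finset.range N, (∑ i ∈ Finset.range j, ε (0 + i) ω).natAbs, ?_⟩
    intro j
    by_cases hj : j < N
    · have := Finset.single_le_sum (f := fun j => (∑ i ∈ Finset.range j, ε (0 + i) ω).natAbs)
        (fun _ _ => Nat.zero_le _) (Finset.mem_range.2 hj)
      omega
    · have h1 := hN j (by omega)
      have h2 : 0 < ∑ i ∈ Finset.range j, (ε i ω : ℝ) := by
        by_contra hc
        have := div_nonpos_of_nonpos_of_nonneg (not_lt.1 hc) (Nat.cast_nonneg (α := ℝ) j)
        linarith
      have h3 : 0 < ∑ i ∈ Finset.range j, ε i ω := by exact_mod_cast h2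
      simp only [zero_add]
      positivity
  have hU : μ (⋃ k : ℕ, stay ε 0 k) = 0 := measure_iUnion_null hk
  have : ∀ᵐ ω ∂μ, False := by
    have h3 : ∀ᵐ ω ∂μ, ω ∉ ⋃ k : ℕ, stay ε 0 k := measure_eq_zero_iff_ae_notMem.1 hU
    filter_upwards [hae, h3] with ω a b
    exact b (Set.mem_iUnion.2 a)
  simp only [Filter.eventually_false_iff_eq_bot, ae_eq_bot] at this
  exact IsProbabilityMeasure.ne_zero μ this

lemma paths {Ω : Type*} [MeasurableSpace Ω] (μ : Measure Ω) [IsProbabilityMeasure μ]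
    (q : ℝ) (hq : 1/2 < q) (hq1 : q < 1)
    (ε : ℕ → Ω → ℤ) (hmeas : ∀ m, Measurable (ε m))
    (hindep : iIndepFun ε μ)
    (hup : ∀ m, μ {ω | ε m ω = 1} = ENNReal.ofReal q)
    (hdown : ∀ m, μ {ω | ε m ω = -1} = ENNReal.ofReal (1 - q))
    (Z S : ℕ → Ω → ℤ) (hZ0 : ∀ ω, Z 0 ω = 0) (hZs : ∀ n ω, Z (n + 1) ω = Z n ω + ε n ω)
    (hS0 : ∀ ω, S 0 ω = 0) (hSs : ∀ n ω, S (n + 1) ω = max (S n ω) (Z (n + 1) ω))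
    (hZS : ∀ n ω, Z n ω ≤ S n ω)
    (hZm : ∀ n, ∀ m ≤ n, Measurable[sg ε {i | i < n}] (Z m))
    (hSm : ∀ n, ∀ m ≤ n, Measurable[sg ε {i | i < n}] (S m))
    (z : ℕ → ℤ) (hz0 : z 0 = 0) (n : ℕ)
    (hz : ∀ m, 1 ≤ m → m ≤ n → z m - z (m-1) = 1 ∨ z m - z (m-1) = -1) :
    ∃ u d : ℕ, z n = u - d ∧ μ.real {ω | ∀ m ≤ n, Z m ω = z m} = q ^ u * (1 - q) ^ d ∧
      ((∀ m ≤ n, 0 ≤ z m) → ∀ s t : ℕ, s + t = u → d ≤ t →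
        μ.real {ω | (∀ m ≤ n, 2 * S m ω - Z m ω = z m) ∧ S n ω = s}
          = q ^ (d + s) * (1 - q) ^ t) := by
  have hE : ∀ n, ∀ a : ℤ, MeasurableSet[sg ε {i | n ≤ i}] {ω | ε n ω = a} := fun n a =>
    (meas_sg ε {i | n ≤ i} n (by simp)) (measurableSet_singleton a)
  have pu : ∀ n, μ.real {ω | ε n ω = 1} = q := fun n => by
    rw [measureReal_def, hup, ENNReal.toReal_ofReal (by linarith)]
  have pd : ∀ n, μ.real {ω | ε n ω = -1} = 1 - q := fun n => by
    rw [measureReal_def, hdown, ENNReal.toReal_ofReal (by linarith)]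
  have mA : ∀ n, MeasurableSet[sg ε {i | i < n}] {ω | ∀ m ≤ n, Z m ω = z m} := by
    intro n
    simp only [Set.setOf_forall]
    refine MeasurableSet.iInter fun m => MeasurableSet.iInter fun hm => ?_
    exact (hZm n m hm) (measurableSet_singleton (z m))
  have mB : ∀ n (s : ℕ), MeasurableSet[sg ε {i | i < n}]
      {ω | (∀ m ≤ n, 2 * S m ω - Z m ω = z m) ∧ S n ω = s} := by
    intro n s
    rw [Set.setOf_and]
    refine MeasurableSet.inter ?_ ((hSm n n le_rfl) (measurableSet_singleton (s : ℤ)))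
    simp only [Set.setOf_forall]
    refine MeasurableSet.iInter fun m => MeasurableSet.iInter fun hm => ?_
    exact (((hSm n m hm).const_mul 2).sub (hZm n m hm)) (measurableSet_singleton (z m))
  have hsucc : ∀ (P : ℕ → Prop) n, (∀ m ≤ n + 1, P m) ↔ (∀ m ≤ n, P m) ∧ P (n + 1) := by
    intro P n
    constructor
    · exact fun h => ⟨fun m hm => h m (by omega), h _ le_rfl⟩
    · rintro ⟨h1, h2⟩ m hm
      rcases Nat.lt_or_ge n m with h | h
      · rwa [show m = n + 1 by omega]
      · exact h1 m h
  have stepA : ∀ n (a : ℤ), z (n + 1) = z n + a →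
      {ω | ∀ m ≤ n + 1, Z m ω = z m} = {ω | ∀ m ≤ n, Z m ω = z m} ∩ {ω | ε n ω = a} := by
    intro n a ha
    ext ω
    simp only [Set.mem_setOf_eq, Set.mem_inter_iff]
    rw [hsucc (fun m => Z m ω = z m)]
    refine and_congr_right fun h => ?_
    have := h n le_rfl
    rw [hZs, ha, this]
    omega
  have stepB : ∀ n (s s' : ℕ) (a : ℤ),
      (∀ ω, (ε n ω = 1 ∨ ε n ω = -1) → 2 * S n ω - Z n ω = z n →
        ((2 * S (n + 1) ω - Z (n + 1) ω = z (n + 1) ∧ S (n + 1) ω = s) ↔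
          (S n ω = s' ∧ ε n ω = a))) →
      μ.real {ω | (∀ m ≤ n + 1, 2 * S m ω - Z m ω = z m) ∧ S (n + 1) ω = s}
        = μ.real {ω | (∀ m ≤ n, 2 * S m ω - Z m ω = z m) ∧ S n ω = s'}
          * μ.real {ω | ε n ω = a} := by
    intro n s s' a h
    rw [← pf μ ε hmeas hindep n _ _ (mB n s') (hE n a)]
    refine measureReal_congr ?_
    rw [Filter.eventuallyEq_set]
    filter_upwards [ident μ q hq hq1 ε hmeas hup hdown n] with ω hω
    simp only [Set.mem_setOf_eq, Set.mem_inter_iff]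
    rw [hsucc (fun m => 2 * S m ω - Z m ω = z m)]
    constructor
    · rintro ⟨⟨h1, h2⟩, h3⟩
      have := (h ω hω (h1 n le_rfl)).1 ⟨h2, h3⟩
      exact ⟨⟨h1, this.1⟩, this.2⟩
    · rintro ⟨⟨h1, h2⟩, h3⟩
      have := (h ω hω (h1 n le_rfl)).2 ⟨h2, h3⟩
      exact ⟨⟨h1, this.1⟩, this.2⟩
  induction n with
  | zero =>
    refine ⟨0, 0, by simp [hz0], ?_, ?_⟩
    · simp [hZ0, hz0]
    · intro _ s t hst _
      obtain ⟨rfl, rfl⟩ : s = 0 ∧ t = 0 := by omega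
      simp [hZ0, hz0, hS0]
  | succ n ih =>
    obtain ⟨u, d, hud, hA, hB⟩ := ih (fun m h1 h2 => hz m h1 (by omega))
    have hst := hz (n + 1) (by omega) le_rfl
    simp only [Nat.add_sub_cancel] at hst
    rcases hst with hst | hst
    · refine ⟨u + 1, d, by push_cast; omega, ?_, ?_⟩
      · rw [stepA n 1 (by omega), pf μ ε hmeas hindep n _ _ (mA n) (hE n 1), hA, pu]
        ring
      · intro hpos s t h1 h2
        have hB' := hB (fun m hm => hpos m (by omega))
        have hzn := hpos n (by omega)
        rcases Nat.lt_or_ge d t with h3 | h3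
        · obtain ⟨t, rfl⟩ : ∃ t', t = t' + 1 := ⟨t - 1, by omega⟩
          rw [stepB n s s (-1) ?_, hB' s t (by omega) (by omega), pd]
          · ring
          · intro ω hω hX
            have := hZS n ω
            rw [hSs, hZs]
            omega
        · obtain ⟨s, rfl⟩ : ∃ s', s = s' + 1 := ⟨s - 1, by omega⟩
          rw [stepB n (s + 1) s 1 ?_, hB' s t (by omega) (by omega), pu]
          · ring
          · intro ω hω hX
            have := hZS n ω
            rw [hSs, hZs]
            push_cast
            omega
    · refine ⟨u, d + 1, by push_cast; omega, ?_, ?_⟩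
      · rw [stepA n (-1) (by omega), pf μ ε hmeas hindep n _ _ (mA n) (hE n (-1)), hA, pd]
        ring
      · intro hpos s t h1 h2
        have hB' := hB (fun m hm => hpos m (by omega))
        have hzn := hpos n (by omega)
        rw [stepB n s s 1 ?_, hB' s t (by omega) (by omega), pu]
        · ring
        · intro ω hω hX
          have := hZS n ω
          rw [hSs, hZs]
          omega

end PitmanAux

open PitmanAux

/-- discrete Pitman theorem: for the simple random walk `Z` with
upward probability `q ∈ (1/2, 1)` and running maximum `S`, the walk stays
non-negative forever with positive probability, and `2S − Z` has the law of `Z`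
conditioned to stay non-negative forever. -/
theorem stmt1 {Ω : Type*} [MeasureSpace Ω] [IsProbabilityMeasure (ℙ : Measure Ω)]
    (q : ℝ) (hq : 1/2 < q) (hq1 : q < 1)
    (ε : ℕ → Ω → ℤ) (hmeas : ∀ m, Measurable (ε m))
    (hindep : iIndepFun ε ℙ)
    (hup : ∀ m, ℙ {ω | ε m ω = 1} = ENNReal.ofReal q)
    (hdown : ∀ m, ℙ {ω | ε m ω = -1} = ENNReal.ofReal (1 - q))
    (Z : ℕ → Ω → ℤ) (hZ : ∀ n ω, Z n ω = ∑ m ∈ Finset.range n, ε m ω)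
    (S : ℕ → Ω → ℤ)
    (hS : ∀ n ω, S n ω = Finset.sup' (Finset.range (n+1)) (by simp) (fun m => Z m ω)) :
    0 < ℙ {ω | ∀ j, 0 ≤ Z j ω} ∧
    ∀ (n : ℕ) (z : ℕ → ℤ), z 0 = 0 →
      (∀ m, 1 ≤ m → m ≤ n → z m - z (m-1) = 1 ∨ z m - z (m-1) = -1) →
      ℙ {ω | ∀ m ≤ n, 2 * S m ω - Z m ω = z m} * ℙ {ω | ∀ j, 0 ≤ Z j ω}
        = ℙ {ω | (∀ m ≤ n, Z m ω = z m) ∧ ∀ j, 0 ≤ Z j ω} := by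
  have hZ0 : ∀ ω, Z 0 ω = 0 := fun ω => by simp [hZ]
  have hZs : ∀ n ω, Z (n + 1) ω = Z n ω + ε n ω := fun n ω => by
    rw [hZ, hZ, Finset.sum_range_succ]
  have hS0 : ∀ ω, S 0 ω = 0 := fun ω => by simp [hS, hZ0]
  have hSs : ∀ n ω, S (n + 1) ω = max (S n ω) (Z (n + 1) ω) := by
    intro n ω
    rw [hS, hS]
    apply le_antisymm
    · refine Finset.sup'_le _ _ fun m hm => ?_
      rw [Finset.mem_range] at hm
      rcases Nat.lt_or_ge m (n + 1) with h | h
      · exact le_max_of_le_left (Finset.le_sup' (fun m => Z m ω) (Finset.mem_range.2 h))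
      · rw [show m = n + 1 by omega]; exact le_max_right _ _
    · refine max_le (Finset.sup'_le _ _ fun m hm => ?_) ?_
      · rw [Finset.mem_range] at hm
        exact Finset.le_sup' (fun m => Z m ω) (Finset.mem_range.2 (by omega))
      · exact Finset.le_sup' (fun m => Z m ω) (Finset.mem_range.2 (by omega))
  have hZS : ∀ n ω, Z n ω ≤ S n ω := by
    intro n ω
    rw [hS]
    exact Finset.le_sup' (fun m => Z m ω) (Finset.mem_range.2 (by omega))
  have hSn : ∀ n ω, 0 ≤ S n ω := by
    intro n ω
    rw [hS, ← hZ0 ω]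
    exact Finset.le_sup' (fun m => Z m ω) (Finset.mem_range.2 (by omega))
  have hZm : ∀ n, ∀ m ≤ n, Measurable[sg ε {i | i < n}] (Z m) := by
    intro n m hm
    rw [show Z m = fun ω => ∑ i ∈ Finset.range m, ε i ω from funext (hZ m)]
    refine Finset.measurable_fun_sum _ fun i hi => ?_
    rw [Finset.mem_range] at hi
    exact meas_sg ε _ _ (show i < n by omega)
  have hSm : ∀ n, ∀ m ≤ n, Measurable[sg ε {i | i < n}] (S m) := by
    intro n m
    induction m with
    | zero =>
      intro _
      rw [show S 0 = fun _ => 0 from funext hS0]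
      exact measurable_const
    | succ m ih =>
      intro hm
      rw [show S (m + 1) = fun ω => max (S m ω) (Z (m + 1) ω) from funext (hSs m)]
      exact (ih (by omega)).max (hZm n _ hm)
  have hst : {ω | ∀ j, 0 ≤ Z j ω} = stay ε 0 0 := by
    ext ω
    simp [stay, hZ]
  rw [hst]
  have hpos := stay_pos ℙ q hq hq1 ε hmeas hindep hup hdown
  refine ⟨pos_iff_ne_zero.2 fun h => hpos (by rw [measureReal_def, h]; rfl), ?_⟩
  intro n z hz0 hz
  by_cases hneg : ∀ m ≤ n, 0 ≤ z m
  swap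
  · push Not at hneg
    obtain ⟨m, hm, hm0⟩ := hneg
    have e1 : {ω | ∀ m ≤ n, 2 * S m ω - Z m ω = z m} = ∅ := by
      ext ω
      simp only [Set.mem_setOf_eq, Set.mem_empty_iff_false, iff_false]
      intro h
      have := h m hm
      have := hZS m ω
      have := hSn m ω
      omega
    have e2 : {ω | (∀ m ≤ n, Z m ω = z m) ∧ ∀ j, 0 ≤ Z j ω} = ∅ := by
      ext ω
      simp only [Set.mem_setOf_eq, Set.mem_empty_iff_false, iff_false]
      rintro ⟨h, h'⟩
      have := h m hm
      have := h' m
      omega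
    rw [e1, e2]
    simp
  obtain ⟨u, d, hud, hA, hB⟩ := paths ℙ q hq hq1 ε hmeas hindep hup hdown Z S hZ0 hZs hS0 hSs hZS
    hZm hSm z hz0 n hz
  replace hB := hB hneg
  have hzn := hneg n le_rfl
  obtain ⟨N, rfl⟩ : ∃ N, u = d + N := ⟨u - d, by omega⟩
  have hzN : z n = (N : ℤ) := by push_cast at hud; omega
  have hle : ∀ T, sg ε T ≤ (inferInstance : MeasurableSpace Ω) := fun T =>
    iSup₂_le fun i _ => (hmeas i).comap_le
  have mA : MeasurableSet[sg ε {i | i < n}] {ω | ∀ m ≤ n, Z m ω = z m} := by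
    simp only [Set.setOf_forall]
    refine MeasurableSet.iInter fun m => MeasurableSet.iInter fun hm => ?_
    exact (hZm n m hm) (measurableSet_singleton (z m))
  have mB : ∀ (s : ℕ), MeasurableSet[sg ε {i | i < n}]
      {ω | (∀ m ≤ n, 2 * S m ω - Z m ω = z m) ∧ S n ω = s} := by
    intro s
    rw [Set.setOf_and]
    refine MeasurableSet.inter ?_ ((hSm n n le_rfl) (measurableSet_singleton (s : ℤ)))
    simp only [Set.setOf_forall]
    refine MeasurableSet.iInter fun m => MeasurableSet.iInter fun hm => ?_
    exact (((hSm n m hm).const_mul 2).sub (hZm n m hm)) (measurableSet_singleton (z m))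
  have eU : {ω | ∀ m ≤ n, 2 * S m ω - Z m ω = z m} = ⋃ s ∈ Finset.range (N + 1),
      {ω | (∀ m ≤ n, 2 * S m ω - Z m ω = z m) ∧ S n ω = (s : ℕ)} := by
    ext ω
    simp only [Set.mem_setOf_eq, Set.mem_iUnion, Finset.mem_range, exists_prop]
    constructor
    · intro h
      have h1 := h n le_rfl
      have h2 := hZS n ω
      have h3 := hSn n ω
      exact ⟨(S n ω).toNat, by omega, h, by omega⟩
    · rintro ⟨s, _, h, _⟩
      exact h
  have PX : (ℙ : Measure Ω).real {ω | ∀ m ≤ n, 2 * S m ω - Z m ω = z m}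
      = q ^ d * (1 - q) ^ d * ∑ s ∈ Finset.range (N + 1), q ^ s * (1 - q) ^ (N + 1 - 1 - s) := by
    rw [eU, measureReal_biUnion_finset _ (fun s _ => hle _ _ (mB s)), Finset.mul_sum]
    · refine Finset.sum_congr rfl fun s hs => ?_
      rw [Finset.mem_range] at hs
      rw [hB s (d + (N - s)) (by omega) (by omega), show N + 1 - 1 - s = N - s by omega]
      ring
    · intro s _ t _ hne
      refine Set.disjoint_left.2 ?_
      rintro ω ⟨_, h1⟩ ⟨_, h2⟩
      apply hne
      omega
  have eR : {ω | (∀ m ≤ n, Z m ω = z m) ∧ ∀ j, 0 ≤ Z j ω}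
      = {ω | ∀ m ≤ n, Z m ω = z m} ∩ stay ε n N := by
    ext ω
    simp only [Set.mem_setOf_eq, Set.mem_inter_iff, stay]
    refine and_congr_right fun h => ?_
    have hn := h n le_rfl
    have e : ∀ j, Z (n + j) ω = N + ∑ i ∈ Finset.range j, ε (n + i) ω := by
      intro j
      rw [hZ, Finset.sum_range_add, ← hZ, hn, hzN]
    constructor
    · intro h' j
      rw [← e]
      exact h' _
    · intro h' j
      rcases Nat.lt_or_ge j n with hj | hj
      · rw [h j hj.le]; exact hneg j hj.le
      · obtain ⟨i, rfl⟩ := Nat.exists_eq_add_of_le hj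
        rw [e]; exact h' i
  have PR : (ℙ : Measure Ω).real {ω | (∀ m ≤ n, Z m ω = z m) ∧ ∀ j, 0 ≤ Z j ω}
      = q ^ (d + N) * (1 - q) ^ d * (ℙ : Measure Ω).real (stay ε 0 N) := by
    rw [eR, pf ℙ ε hmeas hindep n _ _ mA (stay_meas ε n _), hA,
      stay_shift ℙ q hq hq1 ε hmeas hindep hup hdown n]
  have G := stay_geom ℙ q hq hq1 ε hmeas hindep hup hdown N
  rw [← geom_sum₂_mul] at G
  have hne : q - (1 - q) ≠ 0 := by intro h; linarith
  have fin : (ℙ : Measure Ω).real {ω | ∀ m ≤ n, 2 * S m ω - Z m ω = z m}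
      * (ℙ : Measure Ω).real (stay ε 0 0)
      = (ℙ : Measure Ω).real {ω | (∀ m ≤ n, Z m ω = z m) ∧ ∀ j, 0 ≤ Z j ω} := by
    rw [PX, PR]
    apply mul_right_cancel₀ hne
    linear_combination (-(q ^ d * (1 - q) ^ d)) * G
  rw [measureReal_def, measureReal_def, measureReal_def, ← ENNReal.toReal_mul] at fin
  exact (ENNReal.toReal_eq_toReal_iff' (by finiteness) (by finiteness)).1 fin
end

section
/- If the probability vector p satisfies 0<p_1<p_2<⋯<p_k, then the random walk X has positive probability of staying in the Weyl chamber forever: P(X(n)∈W for all n≥0) > 0. -/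
open MeasureTheory ProbabilityTheory

/-- The counting walk of the i.i.d. letters `ξ`:
`Xcnt ξ i n ω = #{m < n : ξ m ω = i}` (as an integer). -/
def Xcnt {Ω : Type*} (ξ : ℕ → Ω → ℕ) (i : ℕ) (n : ℕ) (ω : Ω) : ℤ :=
  ((((Finset.range n).filter (fun m => ξ m ω = i))).card : ℤ)

/-- Counting along a sequence. -/
def cntSeq (a : ℕ → ℕ) (i n : ℕ) : ℤ :=
  (((Finset.range n).filter (fun m => a m = i)).card : ℤ)

lemma cntSeq_eq_sum (a : ℕ → ℕ) (i n : ℕ) :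
    cntSeq a i n = ∑ m ∈ Finset.range n, if a m = i then (1 : ℤ) else 0 := by
  unfold cntSeq
  rw [Finset.card_filter]; push_cast; rfl

lemma cntSeq_add (a : ℕ → ℕ) (i N n : ℕ) :
    cntSeq a i (N + n) = cntSeq a i N + cntSeq (fun m => a (N + m)) i n := by
  simp only [cntSeq_eq_sum]
  rw [Finset.sum_range_add]

lemma cntSeq_fin (a : ℕ → ℕ) (i N : ℕ) :
    cntSeq a i N = ∑ m : Fin N, if a m = i then (1 : ℤ) else 0 := by
  rw [cntSeq_eq_sum, Finset.sum_range]

lemma cntSeq_mono (a : ℕ → ℕ) (i : ℕ) {n N : ℕ} (h : n ≤ N) :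
    cntSeq a i n ≤ cntSeq a i N := by
  obtain ⟨d, rfl⟩ := Nat.exists_eq_add_of_le h
  rw [cntSeq_add]
  have : 0 ≤ cntSeq (fun m => a (n + m)) i d := by unfold cntSeq; positivity
  linarith

/-- A nonincreasing word whose final counts lie in the chamber stays in the chamber. -/
lemma cntSeq_initial (a : ℕ → ℕ) (N i : ℕ) (ha : ∀ m l, m ≤ l → l < N → a l ≤ a m)
    (hN : cntSeq a i N ≤ cntSeq a (i + 1) N) (n : ℕ) (hn : n ≤ N) :
    cntSeq a i n ≤ cntSeq a (i + 1) n := by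
  by_cases h : ∃ m, m < n ∧ a m = i
  · obtain ⟨m, hm, hmi⟩ := h
    have : cntSeq a (i + 1) N = cntSeq a (i + 1) n := by
      unfold cntSeq
      congr 2
      ext l
      simp only [Finset.mem_filter, Finset.mem_range]
      constructor
      · rintro ⟨h1, h2⟩
        refine ⟨?_, h2⟩
        by_contra h3
        have := ha m l (by omega) h1
        omega
      · rintro ⟨h1, h2⟩
        exact ⟨by omega, h2⟩
    have := cntSeq_mono a i hn
    linarith
  · have : cntSeq a i n = 0 := by
      unfold cntSeq
      simp only [Nat.cast_eq_zero, Finset.card_eq_zero, Finset.filter_eq_empty_iff,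
        Finset.mem_range]
      intro m hm h2
      exact h ⟨m, hm, h2⟩
    rw [this]; unfold cntSeq; positivity

lemma measurable_cntSeq (i n : ℕ) : Measurable (fun a : ℕ → ℕ => cntSeq a i n) := by
  simp only [cntSeq_eq_sum]
  refine Finset.measurable_sum _ fun m _ => ?_
  exact (measurable_of_countable (fun x : ℕ => if x = i then (1 : ℤ) else 0)).comp
    (measurable_pi_apply m)

/-- almost surely the walk is eventually ordered in a pair of coordinates -/
lemma ae_eventually {Ω : Type*} [MeasureSpace Ω] [IsProbabilityMeasure (ℙ : Measure Ω)]
    (p : ℕ → ℝ) (ξ : ℕ → Ω → ℕ) (hmeas : ∀ m, Measurable (ξ m))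
    (hindep : iIndepFun ξ ℙ) (hid : ∀ m, IdentDistrib (ξ m) (ξ 0) ℙ ℙ)
    (i j : ℕ) (hi : ℙ {ω | ξ 0 ω = i} = ENNReal.ofReal (p i))
    (hj : ℙ {ω | ξ 0 ω = j} = ENNReal.ofReal (p j)) (hpi : 0 < p i) (hij : p i < p j) :
    ∀ᵐ ω ∂(ℙ : Measure Ω), ∀ᶠ n in Filter.atTop,
      cntSeq (fun m => ξ m ω) i n ≤ cntSeq (fun m => ξ m ω) j n := by
  have key : ∀ l, 0 < p l → ℙ {ω | ξ 0 ω = l} = ENNReal.ofReal (p l) →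
      ∀ᵐ ω ∂(ℙ : Measure Ω), Filter.Tendsto
        (fun n : ℕ => ((cntSeq (fun m => ξ m ω) l n : ℤ) : ℝ) / n) Filter.atTop (nhds (p l)) := by
    intro l hpl hl
    let g : ℕ → ℝ := fun x => if x = l then 1 else 0
    have hg : Measurable g := measurable_of_countable g
    have hms : MeasurableSet {ω | ξ 0 ω = l} := hmeas 0 (measurableSet_singleton l)
    have hgi : (fun ω => g (ξ 0 ω)) = Set.indicator {ω | ξ 0 ω = l} (fun _ => (1 : ℝ)) := by
      ext ω
      simp [g, Set.indicator_apply]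
    have h := strong_law_ae_real (μ := (ℙ : Measure Ω)) (fun m ω => g (ξ m ω))
      (by
        show Integrable (fun ω => g (ξ 0 ω)) ℙ
        rw [hgi]
        exact (integrable_const 1).indicator hms)
      (fun a b hab => (hindep.indepFun hab).comp hg hg)
      (fun m => (hid m).comp hg)
    have he : ∫ ω, g (ξ 0 ω) = p l := by
      rw [hgi, integral_indicator hms]
      simp [Measure.real, hl, hpl.le]
    filter_upwards [h] with ω hω
    simp only [he] at hω
    refine hω.congr fun n => ?_
    rw [cntSeq_eq_sum]
    push_cast
    rfl
  filter_upwards [key i hpi hi, key j (hpi.trans hij) hj] with ω h1 h2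
  filter_upwards [h1.eventually_lt h2 hij, Filter.eventually_gt_atTop 0] with n hn hn0
  have hn0' : (0 : ℝ) < n := by exact_mod_cast hn0
  have := (div_lt_div_iff_of_pos_right hn0').1 hn
  exact_mod_cast this.le

/-- if `p_1 < ⋯ < p_k` then the counting walk stays in the Weyl
chamber `W = {x : x_1 ≤ ⋯ ≤ x_k}` forever with positive probability. -/
theorem stmt7 {Ω : Type*} [MeasureSpace Ω] [IsProbabilityMeasure (ℙ : Measure Ω)]
    (k : ℕ) (hk : 2 ≤ k) (p : ℕ → ℝ)
    (hp0 : ∀ i, i < k → 0 < p i)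
    (hmono : ∀ i j, i < j → j < k → p i < p j)
    (hsum : ∑ i ∈ Finset.range k, p i = 1)
    (ξ : ℕ → Ω → ℕ) (hmeas : ∀ m, Measurable (ξ m))
    (hindep : iIndepFun ξ ℙ)
    (hlaw : ∀ m i, i < k → ℙ {ω | ξ m ω = i} = ENNReal.ofReal (p i)) :
    0 < ℙ {ω | ∀ n, ∀ i, i + 1 < k → Xcnt ξ i n ω ≤ Xcnt ξ (i+1) n ω} := by
  have hX : ∀ i n ω, Xcnt ξ i n ω = cntSeq (fun m => ξ m ω) i n := fun _ _ _ => rfl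
  simp only [hX]
  -- letters outside the alphabet are null
  have hnull : ∀ m i, k ≤ i → ℙ {ω | ξ m ω = i} = 0 := by
    intro m i hi
    have h1 : ℙ {ω | ξ m ω < k} = 1 := by
      have : {ω | ξ m ω < k} = ⋃ i ∈ Finset.range k, {ω | ξ m ω = i} := by
        ext ω; simp
      rw [this, measure_biUnion_finset]
      · rw [Finset.sum_congr rfl (fun i hi => hlaw m i (Finset.mem_range.1 hi)),
          ← ENNReal.ofReal_sum_of_nonneg
            (fun i hi => (hp0 i (Finset.mem_range.1 hi)).le), hsum]
        simp
      · intro a _ b _ hab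
        refine Set.disjoint_left.2 fun ω h1 h2 => hab ?_
        exact h1.symm.trans h2
      · intro b _
        exact hmeas m (measurableSet_singleton b)
    have h2 : ℙ {ω | ξ m ω < k}ᶜ = 0 := by
      rw [prob_compl_eq_zero_iff]
      · exact h1
      · exact hmeas m (measurableSet_Iio (a := k))
    refine measure_mono_null (fun ω hω => ?_) h2
    simp only [Set.mem_ofPred_eq, Set.mem_compl_iff] at hω ⊢
    omega
  have hid : ∀ m, IdentDistrib (ξ m) (ξ 0) ℙ ℙ := by
    intro m
    refine ⟨(hmeas m).aemeasurable, (hmeas 0).aemeasurable, ?_⟩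
    refine Measure.ext_of_singleton fun i => ?_
    rw [Measure.map_apply (hmeas m) (measurableSet_singleton i),
      Measure.map_apply (hmeas 0) (measurableSet_singleton i)]
    show ℙ {ω | ξ m ω = i} = ℙ {ω | ξ 0 ω = i}
    by_cases hi : i < k
    · rw [hlaw m i hi, hlaw 0 i hi]
    · rw [hnull m i (by omega), hnull 0 i (by omega)]
  have hev : ∀ᵐ ω ∂(ℙ : Measure Ω), ∃ N, ∀ n, N ≤ n → ∀ i, i + 1 < k →
      cntSeq (fun m => ξ m ω) i n ≤ cntSeq (fun m => ξ m ω) (i + 1) n := by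
    have h1 : ∀ᵐ ω ∂(ℙ : Measure Ω), ∀ i, i + 1 < k → ∀ᶠ n in Filter.atTop,
        cntSeq (fun m => ξ m ω) i n ≤ cntSeq (fun m => ξ m ω) (i + 1) n := by
      rw [ae_all_iff]
      intro i
      by_cases hi : i + 1 < k
      · filter_upwards [ae_eventually p ξ hmeas hindep hid i (i + 1) (hlaw 0 i (by omega))
          (hlaw 0 _ hi) (hp0 i (by omega)) (hmono i _ (by omega) hi)] with ω hω _
        exact hω
      · exact Filter.Eventually.of_forall fun ω h => absurd h hi
    filter_upwards [h1] with ω hω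
    have h2 : ∀ᶠ n in Filter.atTop, ∀ i ∈ Finset.range (k - 1),
        cntSeq (fun m => ξ m ω) i n ≤ cntSeq (fun m => ξ m ω) (i + 1) n := by
      rw [Filter.eventually_all_finset]
      intro i hi
      exact hω i (by have := Finset.mem_range.1 hi; omega)
    obtain ⟨N, hN⟩ := Filter.eventually_atTop.1 h2
    exact ⟨N, fun n hn i hi => hN n hn i (Finset.mem_range.2 (by omega))⟩
  -- choose `N` and the word
  obtain ⟨N, w, hNw⟩ : ∃ (N : ℕ) (w : Fin N → ℕ), ℙ {ω | (∀ m : Fin N, ξ m ω = w m) ∧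
      ∀ n, N ≤ n → ∀ i, i + 1 < k →
        cntSeq (fun m => ξ m ω) i n ≤ cntSeq (fun m => ξ m ω) (i + 1) n} ≠ 0 := by
    by_contra! hcon
    have h1 : ∀ N : ℕ, ∀ᵐ ω ∂(ℙ : Measure Ω), ∀ w : Fin N → ℕ, ¬ ((∀ m : Fin N, ξ m ω = w m) ∧
      ∀ n, N ≤ n → ∀ i, i + 1 < k →
        cntSeq (fun m => ξ m ω) i n ≤ cntSeq (fun m => ξ m ω) (i + 1) n) := by
      intro N
      rw [ae_all_iff]
      intro w
      rw [ae_iff]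
      simpa only [not_not] using hcon N w
    have h2 := ae_all_iff.2 h1
    have h3 : ∀ᵐ ω ∂(ℙ : Measure Ω), False := by
      filter_upwards [h2, hev] with ω h4 ⟨N, h5⟩
      exact h4 N (fun m => ξ m ω) ⟨fun _ => rfl, h5⟩
    obtain ⟨_, h⟩ := h3.exists
    exact h
  have hwk : ∀ m, w m < k := by
    intro m
    by_contra h
    refine hNw (measure_mono_null (fun ω hω => ?_) (hnull m (w m) (by omega)))
    exact hω.1 m
  -- counts, tail event
  let c : ℕ → ℤ := fun i => ∑ m : Fin N, if w m = i then (1 : ℤ) else 0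
  let S : Set (ℕ → ℕ) := {a | ∀ n i, i + 1 < k →
    c i + cntSeq a i n ≤ c (i + 1) + cntSeq a (i + 1) n}
  have hS : MeasurableSet S := by
    have : S = ⋂ n, ⋂ i, ⋂ (_ : i + 1 < k),
        {a | c i + cntSeq a i n ≤ c (i + 1) + cntSeq a (i + 1) n} := by
      ext a; simp [S]
    rw [this]
    refine MeasurableSet.iInter fun n => MeasurableSet.iInter fun i =>
      MeasurableSet.iInter fun _ => ?_
    exact measurableSet_le ((measurable_cntSeq i n).const_add _)
      ((measurable_cntSeq (i + 1) n).const_add _)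
  let tl : Ω → ℕ → ℕ := fun ω m => ξ (N + m) ω
  have hT : ℙ (tl ⁻¹' S) ≠ 0 := by
    intro h0
    refine hNw (measure_mono_null ?_ h0)
    rintro ω ⟨h1, h2⟩ n i hi
    have hc : ∀ i, c i = cntSeq (fun m => ξ m ω) i N := by
      intro i; rw [cntSeq_fin]; simp only [h1, c]
    have := h2 (N + n) (by omega) i hi
    rw [cntSeq_add, cntSeq_add] at this
    rw [hc, hc]
    exact this
  have hcc : ∀ i, i + 1 < k → c i ≤ c (i + 1) := by
    intro i hi
    obtain ⟨ω, hω⟩ := nonempty_of_measure_ne_zero hT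
    have := hω 0 i hi
    simpa [cntSeq] using this
  -- the sorted word
  let σ : Equiv.Perm (Fin N) := Tuple.sort (fun m => OrderDual.toDual (w m))
  have hσ : ∀ m l : Fin N, m ≤ l → w (σ l) ≤ w (σ m) := fun m l h =>
    Tuple.monotone_sort (fun m => OrderDual.toDual (w m)) h
  let v : ℕ → ℕ := fun m => if h : m < N then w (σ ⟨m, h⟩) else 0
  have hv : ∀ m : Fin N, v m = w (σ m) := fun m => by simp [v]
  let P : Set Ω := ⋂ m ∈ Finset.range N, ξ m ⁻¹' {v m}
  have hP : ℙ P ≠ 0 := by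
    rw [hindep.measure_inter_preimage_eq_mul (Finset.range N) (sets := fun m => {v m})
      (fun m _ => measurableSet_singleton _)]
    rw [Finset.prod_ne_zero_iff]
    intro m hm
    have hm' := Finset.mem_range.1 hm
    have hvk : v m < k := by rw [hv ⟨m, hm'⟩]; exact hwk _
    show ℙ {ω | ξ m ω = v m} ≠ 0
    rw [hlaw m _ hvk]
    simpa using hp0 _ hvk
  have hind : Indep (⨆ m ∈ Set.Iio N, MeasurableSpace.comap (ξ m) inferInstance)
      (⨆ m ∈ Set.Ici N, MeasurableSpace.comap (ξ m) inferInstance) (ℙ : Measure Ω) := by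
    refine indep_iSup_of_disjoint (fun m => (hmeas m).comap_le) hindep ?_
    rw [Set.disjoint_left]
    intro m h1 h2
    simp only [Set.mem_Iio, Set.mem_Ici] at h1 h2
    omega
  have hPm : MeasurableSet[⨆ m ∈ Set.Iio N, MeasurableSpace.comap (ξ m) inferInstance] P := by
    refine Finset.measurableSet_biInter _ fun m hm => ?_
    have hle : MeasurableSpace.comap (ξ m) inferInstance ≤
        ⨆ m ∈ Set.Iio N, MeasurableSpace.comap (ξ m) inferInstance :=
      le_iSup₂_of_le m (Finset.mem_range.1 hm) le_rfl
    exact hle _ ⟨{v m}, measurableSet_singleton _, rfl⟩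
  have hTm : MeasurableSet[⨆ m ∈ Set.Ici N, MeasurableSpace.comap (ξ m) inferInstance]
      (tl ⁻¹' S) := by
    have htl : Measurable[⨆ m ∈ Set.Ici N, MeasurableSpace.comap (ξ m) inferInstance] tl := by
      refine @measurable_pi_lambda _ _ _ (_) _ _ fun m => ?_
      have hle : MeasurableSpace.comap (ξ (N + m)) inferInstance ≤
          ⨆ m ∈ Set.Ici N, MeasurableSpace.comap (ξ m) inferInstance :=
        le_iSup₂_of_le (N + m) (by simp) le_rfl
      intro s hs
      exact hle _ ⟨s, hs, rfl⟩
    exact htl hS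
  have hprod := (Indep_iff _ _ _).1 hind P (tl ⁻¹' S) hPm hTm
  have hpos : ℙ (P ∩ tl ⁻¹' S) ≠ 0 := by
    rw [hprod]; exact mul_ne_zero hP hT
  refine lt_of_lt_of_le (pos_iff_ne_zero.2 hpos) (measure_mono ?_)
  rintro ω ⟨h1, h2⟩ n i hi
  have h1' : ∀ m, m < N → ξ m ω = v m := by
    intro m hm
    have := Set.mem_iInter₂.1 h1 m (Finset.mem_range.2 hm)
    exact this
  have hc : ∀ i, cntSeq (fun m => ξ m ω) i N = c i := by
    intro i
    rw [cntSeq_fin]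
    have : ∀ m : Fin N, ξ m ω = w (σ m) := fun m => by rw [h1' m m.2, hv]
    simp only [this, c]
    exact Equiv.sum_comp σ (fun m => if w m = i then (1 : ℤ) else 0)
  rcases le_total N n with hn | hn
  · obtain ⟨d, rfl⟩ := Nat.exists_eq_add_of_le hn
    rw [cntSeq_add, cntSeq_add, hc, hc]
    exact h2 d i hi
  · refine cntSeq_initial _ N i ?_ ?_ n hn
    · intro m l hml hl
      show ξ l ω ≤ ξ m ω
      rw [h1' l hl, h1' m (by omega), hv ⟨l, hl⟩, hv ⟨m, by omega⟩]
      exact hσ _ _ hml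
    · rw [hc, hc]; exact hcc i hi
end

section
/- Assume 0<p_1<p_2<⋯<p_k. Then for every n∈ℕ and every path g:{0,…,n}→ℤ_+^k with g(0)=0, g(m)−g(m−1)∈{e_1,…,e_k} for 1≤m≤n, and g(m)∈W for all m≤n: P((G^{(k)}(X))(m)=g(m) for all m≤n) · P(X(j)∈W for all j≥0) = P(X(m)=g(m) for all m≤n, and X(j)∈W for all j≥0). In other words, the transformed walk G^{(k)}(X) has the same law as the walk X conditioned never to exit W. -/
open MeasureTheory ProbabilityTheory

noncomputable def minOp (x y : ℕ → ℤ) : ℕ → ℤ := fun n =>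
  Finset.inf' (Finset.range (n+1)) (by simp) (fun m => x m + y n - y m)

noncomputable def maxOp (x y : ℕ → ℤ) : ℕ → ℤ := fun n =>
  Finset.sup' (Finset.range (n+1)) (by simp) (fun m => x m + y n - y m)

/-- `Dseq x i = x 0 ⊓ x 1 ⊓ ⋯ ⊓ x i` (left to right). -/
noncomputable def Dseq (x : ℕ → ℕ → ℤ) : ℕ → (ℕ → ℤ)
  | 0 => x 0
  | i+1 => minOp (Dseq x i) (x (i+1))

/-- `Tseq x i = x (i+1) ⊔ (x 0 ⊓ ⋯ ⊓ x i)`. -/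
noncomputable def Tseq (x : ℕ → ℕ → ℤ) : ℕ → (ℕ → ℤ) :=
  fun i => maxOp (x (i+1)) (Dseq x i)

/-- The path transformation `G^{(k)}` (coordinates `0,…,k-1`). -/
noncomputable def G : ℕ → (ℕ → ℕ → ℤ) → (ℕ → ℕ → ℤ)
  | 0, x => x
  | 1, x => x
  | (k+2), x => fun i => match i with
      | 0 => Dseq x (k+1)
      | (j+1) => G (k+1) (Tseq x) j

namespace GW

/-- letter counts -/
def cnt (l : ℕ → ℕ) (i n : ℕ) : ℤ := (((Finset.range n).filter (fun m => l m = i)).card : ℤ)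

lemma cnt_zero (l : ℕ → ℕ) (i : ℕ) : cnt l i 0 = 0 := by simp [cnt]

lemma cnt_succ (l : ℕ → ℕ) (i n : ℕ) :
    cnt l i (n+1) = cnt l i n + if l n = i then 1 else 0 := by
  unfold cnt
  rw [Finset.range_add_one, Finset.filter_insert]
  split_ifs with h <;> simp

lemma cnt_congr {l l' : ℕ → ℕ} {n : ℕ} (h : ∀ m < n, l m = l' m) (i : ℕ) :
    cnt l i n = cnt l' i n := by
  induction n with
  | zero => simp [cnt_zero]
  | succ n ih => rw [cnt_succ, cnt_succ, ih (fun m hm => h m (by omega)), h n (by omega)]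

/-! ### min / max operations -/

lemma minOp_le (x y : ℕ → ℤ) {m n : ℕ} (h : m ≤ n) : minOp x y n ≤ x m + y n - y m :=
  Finset.inf'_le (fun m => x m + y n - y m) (by simp; omega)

lemma le_minOp {x y : ℕ → ℤ} {n : ℕ} {c : ℤ} (h : ∀ m ≤ n, c ≤ x m + y n - y m) :
    c ≤ minOp x y n :=
  Finset.le_inf' _ _ (fun m hm => h m (by simp at hm; omega))

lemma minOp_attain (x y : ℕ → ℤ) (n : ℕ) : ∃ m ≤ n, minOp x y n = x m + y n - y m := by
  obtain ⟨m, hm, h⟩ := Finset.exists_mem_eq_inf' (s := Finset.range (n+1)) (by simp)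
    (fun m => x m + y n - y m)
  exact ⟨m, by simp at hm; omega, h⟩

lemma le_maxOp (x y : ℕ → ℤ) {m n : ℕ} (h : m ≤ n) : x m + y n - y m ≤ maxOp x y n :=
  Finset.le_sup' (fun m => x m + y n - y m) (by simp; omega)

lemma maxOp_attain (x y : ℕ → ℤ) (n : ℕ) : ∃ m ≤ n, maxOp x y n = x m + y n - y m := by
  obtain ⟨m, hm, h⟩ := Finset.exists_mem_eq_sup' (s := Finset.range (n+1)) (by simp)
    (fun m => x m + y n - y m)
  exact ⟨m, by simp at hm; omega, h⟩

lemma max_eq (x y : ℕ → ℤ) (n : ℕ) : maxOp y x n = x n + y n - minOp x y n := by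
  obtain ⟨m, hm, h⟩ := minOp_attain x y n
  obtain ⟨m', hm', h'⟩ := maxOp_attain y x n
  have := minOp_le x y hm'
  have := le_maxOp y x hm
  omega

lemma minOp_zero (x y : ℕ → ℤ) : minOp x y 0 = x 0 := by
  obtain ⟨m, hm, h⟩ := minOp_attain x y 0
  obtain rfl : m = 0 := by omega
  omega

lemma minOp_succ (x y : ℕ → ℤ) (n : ℕ) :
    minOp x y (n+1) = min (minOp x y n + y (n+1) - y n) (x (n+1)) := by
  apply le_antisymm
  · apply le_min
    · obtain ⟨m, hm, h⟩ := minOp_attain x y n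
      have := minOp_le x y (show m ≤ n+1 by omega)
      omega
    · have := minOp_le x y (le_refl (n+1))
      omega
  · apply le_minOp
    intro m hm
    rcases Nat.lt_or_ge n m with h | h
    · obtain rfl : m = n+1 := by omega
      have := min_le_right (minOp x y n + y (n+1) - y n) (x (n+1))
      omega
    · have := min_le_left (minOp x y n + y (n+1) - y n) (x (n+1))
      have := minOp_le x y h
      omega

lemma Dseq_congr {x y : ℕ → ℕ → ℤ} {j : ℕ} (h : ∀ i ≤ j, x i = y i) : Dseq x j = Dseq y j := by
  induction j with
  | zero => exact h 0 le_rfl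
  | succ j ih => simp only [Dseq]; rw [ih (fun i hi => h i (by omega)), h (j+1) le_rfl]

lemma Tseq_congr {x y : ℕ → ℕ → ℤ} {j : ℕ} (h : ∀ i ≤ j + 1, x i = y i) :
    Tseq x j = Tseq y j := by
  simp only [Tseq]; rw [Dseq_congr (fun i hi => h i (by omega)), h (j+1) le_rfl]

lemma G_congr {k : ℕ} : ∀ {x y : ℕ → ℕ → ℤ}, (∀ i < k, x i = y i) →
    ∀ i < k, G k x i = G k y i := by
  induction k with
  | zero => intro x y h i hi; omega
  | succ k ih =>
    intro x y h i hi
    cases k with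
    | zero => simpa only [G] using h i hi
    | succ k =>
      cases i with
      | zero => simp only [G]; exact Dseq_congr (fun i hi => h i (by omega))
      | succ i =>
        simp only [G]
        exact ih (fun i hi => Tseq_congr (fun j hj => h j (by omega))) i (by omega)

lemma G_zero (k : ℕ) (x : ℕ → ℕ → ℤ) : G (k+1) x 0 = Dseq x k := by
  cases k <;> simp [G, Dseq]

/-! ### machines -/

/-- state after `n` steps -/
def st {S : Type} (f : S × ℕ → S × ℕ) (s : S) (l : ℕ → ℕ) : ℕ → S
  | 0 => s
  | n+1 => (f (st f s l n, l n)).1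

/-- output letters -/
def out {S : Type} (f : S × ℕ → S × ℕ) (s : S) (l : ℕ → ℕ) (n : ℕ) : ℕ :=
  (f (st f s l n, l n)).2

structure Mach where
  S : Type
  step : S × ℕ ≃ S × ℕ
  wt : S → ENNReal
  zero : S
  size : S → ℕ

structure Mach.Good (P : ℕ → ENNReal) (M : Mach) : Prop where
  wt_step : ∀ x, M.wt (M.step x).1 * P (M.step x).2 = M.wt x.1 * P x.2
  wt_zero : M.wt M.zero = 1
  wt_sum : ∑' s, M.wt s ≠ ⊤

/-- trivial machine -/
noncomputable def idM : Mach := ⟨Unit, Equiv.refl _, fun _ => 1, (), fun _ => 0⟩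

def compE {S T : Type} (e : S × ℕ ≃ S × ℕ) (f : T × ℕ ≃ T × ℕ) :
    (S × T) × ℕ ≃ (S × T) × ℕ where
  toFun x := (((e (x.1.1, x.2)).1, (f (x.1.2, (e (x.1.1, x.2)).2)).1),
    (f (x.1.2, (e (x.1.1, x.2)).2)).2)
  invFun y := (((e.symm (y.1.1, (f.symm (y.1.2, y.2)).2)).1, (f.symm (y.1.2, y.2)).1),
    (e.symm (y.1.1, (f.symm (y.1.2, y.2)).2)).2)
  left_inv x := by simp
  right_inv y := by simp

noncomputable def comp (M N : Mach) : Mach :=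
  ⟨M.S × N.S, compE M.step N.step, fun s => M.wt s.1 * N.wt s.2, (M.zero, N.zero),
    fun s => M.size s.1 + N.size s.2⟩

/-- queue step: arrivals `a`, services `b` -/
def qstep (a b : ℕ) (x : ℕ × ℕ) : ℕ × ℕ :=
  if x.2 = a then (x.1 + 1, b) else
  if x.2 = b then (if x.1 = 0 then (0, b) else (x.1 - 1, a)) else x

lemma qstep_inv (a j : ℕ) : Function.Involutive (qstep a (a+j+1)) := by
  rintro ⟨q, l⟩
  unfold qstep
  grind

noncomputable def queue (P : ℕ → ENNReal) (a j : ℕ) : Mach :=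
  ⟨ℕ, (qstep_inv a j).toPerm, fun q => (P a / P (a+j+1))^q, 0, fun q => q⟩

noncomputable def row (P : ℕ → ENNReal) (c : ℕ) : ℕ → Mach
  | 0 => idM
  | j+1 => comp (row P c j) (queue P c j)

noncomputable def tri (P : ℕ → ENNReal) : ℕ → ℕ → Mach
  | _, 0 => idM
  | c, k+1 => comp (row P c k) (tri P (c+1) k)

lemma good_id (P : ℕ → ENNReal) : idM.Good P :=
  ⟨fun x => rfl, rfl, by
    have : ∑' s : Unit, (1 : ENNReal) = 1 := by simp
    exact this ▸ ENNReal.one_ne_top⟩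

lemma good_comp {P : ℕ → ENNReal} {M N : Mach} (hM : M.Good P) (hN : N.Good P) :
    (comp M N).Good P := by
  refine ⟨?_, ?_, ?_⟩
  · rintro ⟨⟨s, t⟩, l⟩
    have h1 := hM.wt_step (s, l)
    have h2 := hN.wt_step (t, (M.step (s, l)).2)
    change M.wt (M.step (s, l)).1 * N.wt (N.step (t, (M.step (s, l)).2)).1 *
      P (N.step (t, (M.step (s, l)).2)).2 = M.wt s * N.wt t * P l
    dsimp only at h1 h2
    rw [mul_assoc, h2, mul_left_comm, h1]
    ring
  · simp [comp, hM.wt_zero, hN.wt_zero]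
  · have : ∑' s : M.S × N.S, M.wt s.1 * N.wt s.2 = (∑' s, M.wt s) * ∑' t, N.wt t := by
      rw [ENNReal.tsum_prod', ← ENNReal.tsum_mul_right]
      simp_rw [ENNReal.tsum_mul_left]
    exact this ▸ ENNReal.mul_ne_top hM.wt_sum hN.wt_sum

lemma good_queue {P : ℕ → ENNReal} {a j : ℕ} (h : P a < P (a+j+1)) (ht : P (a+j+1) ≠ ⊤) :
    (queue P a j).Good P := by
  have h0 : P (a+j+1) ≠ 0 := (bot_le.trans_lt h).ne'
  have hr : P a / P (a+j+1) * P (a+j+1) = P a := ENNReal.div_mul_cancel h0 ht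
  refine ⟨?_, ?_, ?_⟩
  · rintro ⟨q, l⟩
    change ℕ at q
    change (P a / P (a+j+1))^(qstep a (a+j+1) (q, l)).1 * P (qstep a (a+j+1) (q, l)).2 =
      (P a / P (a+j+1))^(q : ℕ) * P l
    simp only [qstep]
    split_ifs with h1 h2 h3
    · subst h1; simp only; rw [pow_succ, mul_assoc, hr]
    · subst h2; subst h3; rfl
    · subst h2
      obtain ⟨q, rfl⟩ : ∃ r, q = r + 1 := ⟨q - 1, by omega⟩
      simp only [Nat.add_sub_cancel]; rw [pow_succ, mul_assoc, hr]
    · rfl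
  · simp [queue]
  · have : ∑' q : ℕ, (P a / P (a+j+1))^q = (1 - P a / P (a+j+1))⁻¹ := ENNReal.tsum_geometric _
    have h2 : (1 - P a / P (a+j+1))⁻¹ ≠ ⊤ := by
      rw [ENNReal.inv_ne_top]
      have : P a / P (a+j+1) < 1 := by
        rw [ENNReal.div_lt_iff (Or.inl h0) (Or.inl ht)]; simpa
      exact (tsub_pos_of_lt this).ne'
    exact this ▸ h2

lemma good_row {P : ℕ → ENNReal} {k : ℕ} (h : ∀ i j, i < j → j < k → P i < P j ∧ P j ≠ ⊤)
    (c j : ℕ) (hj : c + j < k) : (row P c j).Good P := by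
  induction j with
  | zero => exact good_id P
  | succ j ih =>
    have := h c (c+j+1) (by omega) (by omega)
    exact good_comp (ih (by omega)) (good_queue this.1 this.2)

lemma good_tri {P : ℕ → ENNReal} {k : ℕ} (h : ∀ i j, i < j → j < k → P i < P j ∧ P j ≠ ⊤)
    (j : ℕ) : ∀ c, c + j ≤ k → (tri P c j).Good P := by
  induction j with
  | zero => intro c _; exact good_id P
  | succ j ih => intro c hc; exact good_comp (good_row h c j (by omega)) (ih _ (by omega))

/-! ### trajectories -/

lemma st_comp (M N : Mach) (s : M.S) (t : N.S) (l : ℕ → ℕ) (n : ℕ) :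
    st (comp M N).step (s, t) l n = (st M.step s l n, st N.step t (out M.step s l) n) := by
  induction n with
  | zero => rfl
  | succ n ih => simp only [st]; rw [ih]; rfl

lemma out_comp (M N : Mach) (s : M.S) (t : N.S) (l : ℕ → ℕ) :
    out (comp M N).step (s, t) l = out N.step t (out M.step s l) := by
  funext n
  simp only [out]; rw [st_comp]; rfl

lemma out_id (s : Unit) (l : ℕ → ℕ) : out idM.step s l = l := by
  funext n; rfl

section queue
variable (a j : ℕ) (q : ℕ) (l : ℕ → ℕ)

local notation "Q" => st (qstep a (a+j+1)) q l
local notation "O" => out (qstep a (a+j+1)) q l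

lemma q_other (i : ℕ) (h1 : i ≠ a) (h2 : i ≠ a+j+1) (n : ℕ) : cnt O i n = cnt l i n := by
  induction n with
  | zero => simp [cnt_zero]
  | succ n ih =>
    rw [cnt_succ, cnt_succ, ih]
    congr 1
    simp only [out, qstep]
    grind

/-- all one-step information about the queue -/
lemma q_step (n : ℕ) :
    (cnt O a (n+1) + Q (n+1) - cnt l a (n+1) = cnt O a n + Q n - cnt l a n) ∧
    (cnt O a (n+1) + cnt O (a+j+1) (n+1) - cnt l a (n+1) - cnt l (a+j+1) (n+1) =
      cnt O a n + cnt O (a+j+1) n - cnt l a n - cnt l (a+j+1) n) ∧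
    ((Q n : ℤ) = max 0 (Q (n+1) + (cnt O a (n+1) - cnt O a n)
      - (cnt O (a+j+1) (n+1) - cnt O (a+j+1) n))) ∧
    ((Q (n+1) : ℤ) = max 0 (Q n + (cnt l a (n+1) - cnt l a n)
      - (cnt l (a+j+1) (n+1) - cnt l (a+j+1) n))) := by
  simp only [cnt_succ]
  have h1 : O n = (qstep a (a+j+1) (Q n, l n)).2 := rfl
  have h2 : Q (n+1) = (qstep a (a+j+1) (Q n, l n)).1 := rfl
  rw [h1, h2]
  generalize Q n = r
  generalize l n = x
  simp only [qstep]
  by_cases ha : x = a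
  · subst ha
    simp; omega
  · by_cases hb : x = a + j + 1
    · subst hb
      have ha' : a ≠ a + j + 1 := by omega
      by_cases hr : r = 0
      · subst hr; simp [ha'.symm]; ring
      · simp [hr, ha', ha'.symm]; omega
    · simp [ha, hb]

lemma q_inv (n : ℕ) : cnt l a n + q = cnt O a n + Q n ∧
    cnt O a n + cnt O (a+j+1) n = cnt l a n + cnt l (a+j+1) n := by
  induction n with
  | zero => simp [cnt_zero, st]
  | succ n ih =>
    have := q_step a j q l n
    omega

/-- backward bound -/
lemma q_back (N : ℕ) (s : ℕ) (hs : s ≤ N) (T : ℤ)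
    (h1 : ∀ u, s ≤ u → u ≤ N → cnt O a u ≤ T + cnt O (a+j+1) u - cnt O (a+j+1) s)
    (h2 : cnt O a N + Q N ≤ T + cnt O (a+j+1) N - cnt O (a+j+1) s) :
    cnt O a s + Q s ≤ T := by
  have key : ∀ d u, u + d = N → s ≤ u →
      cnt O a u + Q u - cnt O (a+j+1) u ≤ T - cnt O (a+j+1) s := by
    intro d
    induction d with
    | zero => intro u hu hsu; obtain rfl : u = N := by omega
              omega
    | succ d ih =>
      intro u hu hsu
      have := ih (u+1) (by omega) (by omega)
      have h3 := (q_step a j q l u).2.2.1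
      have := h1 u hsu (by omega)
      rcases max_cases (0:ℤ) (Q (u+1) + (cnt O a (u+1) - cnt O a u)
        - (cnt O (a+j+1) (u+1) - cnt O (a+j+1) u)) with h | h <;> omega
  have := key (N - s) s (by omega) le_rfl
  omega

/-- forward bound -/
lemma q_fwd (s u : ℕ) (hs : s ≤ u) :
    cnt O a u - cnt O (a+j+1) u ≤ cnt O a s + Q s - cnt O (a+j+1) s := by
  have key : ∀ u, s ≤ u → cnt O a u + Q u - cnt O (a+j+1) u ≤
      cnt O a s + Q s - cnt O (a+j+1) s := by
    intro u hu
    induction u, hu using Nat.le_induction with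
    | base => exact le_rfl
    | succ u hu ih =>
      have h3 := (q_step a j q l u).2.2.1
      have := le_max_right (0:ℤ) (Q (u+1) + (cnt O a (u+1) - cnt O a u)
        - (cnt O (a+j+1) (u+1) - cnt O (a+j+1) u))
      omega
  have := key u hs
  omega

end queue

lemma q_min (a j : ℕ) (l : ℕ → ℕ) (n : ℕ) :
    cnt (out (qstep a (a+j+1)) 0 l) a n = minOp (cnt l a) (cnt l (a+j+1)) n := by
  induction n with
  | zero => simp [minOp_zero, cnt_zero]
  | succ n ih =>
    rw [minOp_succ, ← ih]
    have h1 := q_inv a j 0 l n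
    have h2 := q_inv a j 0 l (n+1)
    have h3 := (q_step a j 0 l n).2.2.2
    omega

lemma q_max (a j : ℕ) (l : ℕ → ℕ) (n : ℕ) :
    cnt (out (qstep a (a+j+1)) 0 l) (a+j+1) n = maxOp (cnt l (a+j+1)) (cnt l a) n := by
  rw [max_eq, ← q_min]
  have h1 := q_inv a j 0 l n
  omega

/-! ### rows -/

lemma row_other (P : ℕ → ENNReal) (c j : ℕ) : ∀ (s : (row P c j).S) (l : ℕ → ℕ) (i : ℕ),
    (i < c ∨ c + j < i) → cnt (out (row P c j).step s l) i = cnt l i := by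
  induction j with
  | zero => intro s l i _; exact congrArg (fun l => cnt l i) (out_id s l)
  | succ j ih =>
    rintro ⟨s, q⟩ l i hi
    have h := out_comp (row P c j) (queue P c j) s q l
    change cnt (out (comp (row P c j) (queue P c j)).step (s, q) l) i = _
    rw [h, ← ih s l i (by omega)]
    funext n
    exact q_other c j q _ i (by omega) (by omega) n

lemma row_G (P : ℕ → ENNReal) (c j : ℕ) : ∀ (l : ℕ → ℕ),
    cnt (out (row P c j).step (row P c j).zero l) c = Dseq (fun i => cnt l (c+i)) j ∧
    ∀ i < j, cnt (out (row P c j).step (row P c j).zero l) (c+1+i) =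
      Tseq (fun i => cnt l (c+i)) i := by
  induction j with
  | zero =>
    intro l
    refine ⟨congrArg (fun l => cnt l c) (out_id () l), fun i hi => by omega⟩
  | succ j ih =>
    intro l
    have h := out_comp (row P c j) (queue P c j) (row P c j).zero (queue P c j).zero l
    change cnt (out (comp (row P c j) (queue P c j)).step
        ((row P c j).zero, (queue P c j).zero) l) c = _ ∧ ∀ i < j+1,
      cnt (out (comp (row P c j) (queue P c j)).step
        ((row P c j).zero, (queue P c j).zero) l) (c+1+i) = _
    rw [h]
    have h1 := (ih l).1
    have h2 := (ih l).2
    have h3 := row_other P c j (row P c j).zero l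
    set m := out (row P c j).step (row P c j).zero l
    refine ⟨?_, ?_⟩
    · funext n
      refine (q_min c j m n).trans ?_
      rw [h1, h3 (c+j+1) (by omega)]
      rfl
    · intro i hi
      rcases Nat.lt_or_ge i j with hij | hij
      · rw [← h2 i hij]
        funext n
        exact q_other c j 0 m _ (by omega) (by omega) n
      · obtain rfl : i = j := by omega
        funext n
        have := (q_max c i m n)
        rw [h1, h3 (c+i+1) (by omega)] at this
        rw [show c + 1 + i = c + i + 1 by omega]
        exact this

lemma row_fwd (P : ℕ → ENNReal) (c j : ℕ) : ∀ (l : ℕ → ℕ) (n : ℕ),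
    cnt (out (row P c (j+1)).step (row P c (j+1)).zero l) c n ≤
    Dseq (fun i => cnt (out (row P c (j+1)).step (row P c (j+1)).zero l) (c+1+i)) j n := by
  induction j with
  | zero =>
    intro l n
    have h := out_comp (row P c 0) (queue P c 0) (row P c 0).zero (queue P c 0).zero l
    change cnt (out (comp (row P c 0) (queue P c 0)).step
        ((row P c 0).zero, (queue P c 0).zero) l) c n ≤
      cnt (out (comp (row P c 0) (queue P c 0)).step
        ((row P c 0).zero, (queue P c 0).zero) l) (c+1) n
    rw [h]
    have := q_fwd c 0 0 (out (row P c 0).step (row P c 0).zero l) 0 n (by omega)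
    simp only [cnt_zero, st] at this
    change cnt (out (qstep c (c+0+1)) 0 (out (row P c 0).step (row P c 0).zero l)) c n ≤
      cnt (out (qstep c (c+0+1)) 0 (out (row P c 0).step (row P c 0).zero l)) (c+0+1) n
    push_cast at this
    linarith
  | succ j ih =>
    intro l n
    have h := out_comp (row P c (j+1)) (queue P c (j+1)) (row P c (j+1)).zero
      (queue P c (j+1)).zero l
    change cnt (out (comp (row P c (j+1)) (queue P c (j+1))).step
        ((row P c (j+1)).zero, (queue P c (j+1)).zero) l) c n ≤
      Dseq (fun i => cnt (out (comp (row P c (j+1)) (queue P c (j+1))).step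
        ((row P c (j+1)).zero, (queue P c (j+1)).zero) l) (c+1+i)) (j+1) n
    rw [h]
    have ih' := ih l
    set m := out (row P c (j+1)).step (row P c (j+1)).zero l
    change cnt (out (qstep c (c+(j+1)+1)) 0 m) c n ≤
      minOp (Dseq (fun i => cnt (out (qstep c (c+(j+1)+1)) 0 m) (c+1+i)) j)
        (cnt (out (qstep c (c+(j+1)+1)) 0 m) (c+1+(j+1))) n
    rw [Dseq_congr (y := fun i => cnt m (c+1+i)) (fun i hi => by
      funext n; exact q_other c (j+1) 0 m _ (by omega) (by omega) n)]
    rw [show c + 1 + (j+1) = c + (j+1) + 1 by omega]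
    apply le_minOp
    intro s hs
    have h1 := ih' s
    have h2 := q_fwd c (j+1) 0 m s n hs
    have h3 := q_inv c (j+1) 0 m s
    push_cast at h3
    linarith [h3.1]

lemma row_back (P : ℕ → ENNReal) (c N j : ℕ) : ∀ (s : (row P c (j+1)).S) (l : ℕ → ℕ),
    (∀ u ≤ N, cnt (out (row P c (j+1)).step s l) c u ≤
      Dseq (fun i => cnt (out (row P c (j+1)).step s l) (c+1+i)) j u) →
    (cnt (out (row P c (j+1)).step s l) c N +
      (row P c (j+1)).size (st (row P c (j+1)).step s l N) ≤
      Dseq (fun i => cnt (out (row P c (j+1)).step s l) (c+1+i)) j N) →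
    s = (row P c (j+1)).zero := by
  induction j with
  | zero =>
    rintro ⟨s, q⟩ l
    have h := out_comp (row P c 0) (queue P c 0) s q l
    have hs := st_comp (row P c 0) (queue P c 0) s q l N
    intro h1 h2
    change ∀ u ≤ N, cnt (out (comp (row P c 0) (queue P c 0)).step (s, q) l) c u ≤
      cnt (out (comp (row P c 0) (queue P c 0)).step (s, q) l) (c+1) u at h1
    change cnt (out (comp (row P c 0) (queue P c 0)).step (s, q) l) c N +
      (comp (row P c 0) (queue P c 0)).size
        (st (comp (row P c 0) (queue P c 0)).step (s, q) l N) ≤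
      cnt (out (comp (row P c 0) (queue P c 0)).step (s, q) l) (c+1) N at h2
    rw [h] at h1
    rw [h, hs] at h2
    set m := out (row P c 0).step s l
    change ∀ u ≤ N, cnt (out (qstep c (c+0+1)) q m) c u ≤
      cnt (out (qstep c (c+0+1)) q m) (c+0+1) u at h1
    change cnt (out (qstep c (c+0+1)) q m) c N + ((0 + st (qstep c (c+0+1)) q m N : ℕ) : ℤ) ≤
      cnt (out (qstep c (c+0+1)) q m) (c+0+1) N at h2
    have := q_back c 0 q m N 0 (by omega) 0 (fun u _ hu => by
      have := h1 u hu; rw [cnt_zero]; linarith) (by rw [cnt_zero]; push_cast at h2; linarith)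
    rw [cnt_zero] at this
    simp only [st] at this
    change ℕ at q
    obtain rfl : q = 0 := by omega
    rfl
  | succ j ih =>
    rintro ⟨s, q⟩ l
    have h := out_comp (row P c (j+1)) (queue P c (j+1)) s q l
    have hs := st_comp (row P c (j+1)) (queue P c (j+1)) s q l N
    intro h1 h2
    change ∀ u ≤ N, cnt (out (comp (row P c (j+1)) (queue P c (j+1))).step (s, q) l) c u ≤
      Dseq (fun i => cnt (out (comp (row P c (j+1)) (queue P c (j+1))).step (s, q) l) (c+1+i))
        (j+1) u at h1
    change cnt (out (comp (row P c (j+1)) (queue P c (j+1))).step (s, q) l) c N +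
      (comp (row P c (j+1)) (queue P c (j+1))).size
        (st (comp (row P c (j+1)) (queue P c (j+1))).step (s, q) l N) ≤
      Dseq (fun i => cnt (out (comp (row P c (j+1)) (queue P c (j+1))).step (s, q) l) (c+1+i))
        (j+1) N at h2
    rw [h] at h1
    rw [h, hs] at h2
    have ih' := ih s l
    set m := out (row P c (j+1)).step s l
    change ℕ at q
    have hD : Dseq (fun i => cnt (out (qstep c (c+(j+1)+1)) q m) (c+1+i)) j =
        Dseq (fun i => cnt m (c+1+i)) j := Dseq_congr (fun i hi => by
      funext n; exact q_other c (j+1) q m _ (by omega) (by omega) n)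
    have e : c + 1 + (j+1) = c + (j+1) + 1 := by omega
    change ∀ u ≤ N, cnt (out (qstep c (c+(j+1)+1)) q m) c u ≤
      minOp (Dseq (fun i => cnt (out (qstep c (c+(j+1)+1)) q m) (c+1+i)) j)
        (cnt (out (qstep c (c+(j+1)+1)) q m) (c+1+(j+1))) u at h1
    change cnt (out (qstep c (c+(j+1)+1)) q m) c N +
      (((row P c (j+1)).size (st (row P c (j+1)).step s l N) +
        st (qstep c (c+(j+1)+1)) q m N : ℕ) : ℤ) ≤
      minOp (Dseq (fun i => cnt (out (qstep c (c+(j+1)+1)) q m) (c+1+i)) j)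
        (cnt (out (qstep c (c+(j+1)+1)) q m) (c+1+(j+1))) N at h2
    rw [hD, e] at h1 h2
    push_cast at h2
    set T := Dseq (fun i => cnt m (c+1+i)) j with hT
    have hz : (0 : ℤ) ≤ ((row P c (j+1)).size (st (row P c (j+1)).step s l N) : ℤ) := by
      positivity
    have key : ∀ r ≤ N, cnt (out (qstep c (c+(j+1)+1)) q m) c r +
        st (qstep c (c+(j+1)+1)) q m r ≤ T r := by
      intro r hr
      refine q_back c (j+1) q m N r hr (T r) (fun u hu1 hu2 => ?_) ?_
      · exact (h1 u hu2).trans (minOp_le _ _ hu1)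
      · have := minOp_le T (cnt (out (qstep c (c+(j+1)+1)) q m) (c+(j+1)+1)) hr
        linarith
    have hT0 : ∀ i, Dseq (fun i => cnt m (c+1+i)) i 0 = 0 := by
      intro i
      induction i with
      | zero => exact cnt_zero _ _
      | succ i ih => simp only [Dseq]; rw [minOp_zero, ih]
    have q0 := key 0 (by omega)
    rw [cnt_zero, hT, hT0] at q0
    simp only [st] at q0
    obtain rfl : q = 0 := by omega
    have hs0 : s = (row P c (j+1)).zero := by
      apply ih'
      · intro u hu
        have := key u hu
        have h3 := (q_inv c (j+1) 0 m u).1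
        push_cast at h3
        linarith
      · have h3 := (q_inv c (j+1) 0 m N).1
        have := minOp_le T (cnt (out (qstep c (c+(j+1)+1)) 0 m) (c+(j+1)+1)) (le_refl N)
        push_cast at h3
        linarith
    subst hs0
    rfl

/-! ### triangles -/

lemma tri_other (P : ℕ → ENNReal) (k : ℕ) : ∀ (c : ℕ) (s : (tri P c k).S) (l : ℕ → ℕ) (i : ℕ),
    i < c → cnt (out (tri P c k).step s l) i = cnt l i := by
  induction k with
  | zero => intro c s l i _; exact congrArg (fun l => cnt l i) (out_id s l)
  | succ k ih =>
    rintro c ⟨s, t⟩ l i hi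
    have h := out_comp (row P c k) (tri P (c+1) k) s t l
    change cnt (out (comp (row P c k) (tri P (c+1) k)).step (s, t) l) i = _
    rw [h, ih _ _ _ _ (by omega), row_other _ _ _ _ _ _ (by omega)]

lemma tri_G (P : ℕ → ENNReal) (k : ℕ) : ∀ (c : ℕ) (l : ℕ → ℕ) (i : ℕ), i < k →
    cnt (out (tri P c k).step (tri P c k).zero l) (c+i) = G k (fun i => cnt l (c+i)) i := by
  induction k with
  | zero => intro c l i hi; omega
  | succ k ih =>
    intro c l i hi
    have h := out_comp (row P c k) (tri P (c+1) k) (row P c k).zero (tri P (c+1) k).zero l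
    change cnt (out (comp (row P c k) (tri P (c+1) k)).step
      ((row P c k).zero, (tri P (c+1) k).zero) l) (c+i) = _
    rw [h]
    cases i with
    | zero =>
      rw [tri_other _ _ _ _ _ _ (by omega), G_zero]
      exact (row_G P c k l).1
    | succ i =>
      cases k with
      | zero => omega
      | succ k =>
        rw [show c + (i+1) = c + 1 + i by omega, ih _ _ _ (by omega)]
        simp only [G]
        exact G_congr (fun i hi => (row_G P c (k+1) l).2 i hi) i (by omega)

lemma tri_fwd (P : ℕ → ENNReal) (k : ℕ) : ∀ (c : ℕ) (l : ℕ → ℕ) (i n : ℕ), i + 1 < k →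
    cnt (out (tri P c k).step (tri P c k).zero l) (c+i) n ≤
    cnt (out (tri P c k).step (tri P c k).zero l) (c+i+1) n := by
  induction k with
  | zero => intro c l i n hi; omega
  | succ k ih =>
    intro c l i n hi
    have h := out_comp (row P c k) (tri P (c+1) k) (row P c k).zero (tri P (c+1) k).zero l
    change cnt (out (comp (row P c k) (tri P (c+1) k)).step
      ((row P c k).zero, (tri P (c+1) k).zero) l) (c+i) n ≤
      cnt (out (comp (row P c k) (tri P (c+1) k)).step
      ((row P c k).zero, (tri P (c+1) k).zero) l) (c+i+1) n
    rw [h]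
    cases i with
    | zero =>
      obtain ⟨k, rfl⟩ : ∃ j, k = j + 1 := ⟨k - 1, by omega⟩
      rw [tri_other _ _ _ _ _ _ (by omega)]
      have := tri_G P (k+1) (c+1) (out (row P c (k+1)).step (row P c (k+1)).zero l) 0 (by omega)
      rw [G_zero] at this
      simp only [Nat.add_zero] at this ⊢
      rw [this]
      exact row_fwd P c k l n
    | succ i =>
      have := ih (c+1) (out (row P c k).step (row P c k).zero l) i n (by omega)
      rw [show c + 1 + i = c + (i + 1) by omega] at this
      exact this

lemma tri_back (P : ℕ → ENNReal) (N k : ℕ) : ∀ (c : ℕ) (s : (tri P c k).S) (l : ℕ → ℕ),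
    (∀ i, i + 1 < k → ∀ u ≤ N, cnt (out (tri P c k).step s l) (c+i) u ≤
      cnt (out (tri P c k).step s l) (c+i+1) u) →
    (∀ i, i + 1 < k → cnt (out (tri P c k).step s l) (c+i) N +
      (tri P c k).size (st (tri P c k).step s l N) ≤
      cnt (out (tri P c k).step s l) (c+i+1) N) →
    s = (tri P c k).zero := by
  induction k with
  | zero => intro c s l _ _; rfl
  | succ k ih =>
    rintro c ⟨s, t⟩ l h1 h2
    have h := out_comp (row P c k) (tri P (c+1) k) s t l
    have hs := st_comp (row P c k) (tri P (c+1) k) s t l N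
    change ∀ i, i + 1 < k + 1 → ∀ u ≤ N,
      cnt (out (comp (row P c k) (tri P (c+1) k)).step (s, t) l) (c+i) u ≤
      cnt (out (comp (row P c k) (tri P (c+1) k)).step (s, t) l) (c+i+1) u at h1
    change ∀ i, i + 1 < k + 1 →
      cnt (out (comp (row P c k) (tri P (c+1) k)).step (s, t) l) (c+i) N +
      (comp (row P c k) (tri P (c+1) k)).size
        (st (comp (row P c k) (tri P (c+1) k)).step (s, t) l N) ≤
      cnt (out (comp (row P c k) (tri P (c+1) k)).step (s, t) l) (c+i+1) N at h2
    rw [h] at h1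
    rw [h, hs] at h2
    change ∀ i, i + 1 < k + 1 →
      cnt (out (tri P (c+1) k).step t (out (row P c k).step s l)) (c+i) N +
      (((row P c k).size (st (row P c k).step s l N) +
        (tri P (c+1) k).size (st (tri P (c+1) k).step t (out (row P c k).step s l) N) : ℕ) : ℤ) ≤
      cnt (out (tri P (c+1) k).step t (out (row P c k).step s l)) (c+i+1) N at h2
    push_cast at h2
    have ht : t = (tri P (c+1) k).zero := by
      apply ih (c+1) t (out (row P c k).step s l)
      · intro i hi u hu
        have := h1 (i+1) (by omega) u hu
        rw [show c + (i + 1) = c + 1 + i by omega] at this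
        exact this
      · intro i hi
        have := h2 (i+1) (by omega)
        rw [show c + (i + 1) = c + 1 + i by omega] at this
        have hz : (0 : ℤ) ≤ ((row P c k).size (st (row P c k).step s l N) : ℤ) := by
          positivity
        linarith
    subst ht
    have hs0 : s = (row P c k).zero := by
      cases k with
      | zero => rfl
      | succ k =>
        have hG := tri_G P (k+1) (c+1) (out (row P c (k+1)).step s l) 0 (by omega)
        rw [G_zero] at hG
        simp only [Nat.add_zero] at hG
        have hO := tri_other P (k+1) (c+1) (tri P (c+1) (k+1)).zero
          (out (row P c (k+1)).step s l) c (by omega)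
        apply row_back P c N k s l
        · intro u hu
          have := h1 0 (by omega) u hu
          simp only [Nat.add_zero] at this
          rwa [hG, hO] at this
        · have := h2 0 (by omega)
          simp only [Nat.add_zero] at this
          rw [hG, hO] at this
          have hz : (0 : ℤ) ≤ ((tri P (c+1) (k+1)).size (st (tri P (c+1) (k+1)).step
            (tri P (c+1) (k+1)).zero (out (row P c (k+1)).step s l) N) : ℤ) := by
            positivity
          linarith
    subst hs0
    rfl

/-! ### words -/

def run {S : Type} (f : S × ℕ → S × ℕ) : S → List ℕ → S × List ℕ
  | s, [] => (s, [])
  | s, l :: w => ((run f (f (s, l)).1 w).1, (f (s, l)).2 :: (run f (f (s, l)).1 w).2)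

def runInv {S : Type} (f : S × ℕ → S × ℕ) : S → List ℕ → S × List ℕ
  | s, [] => (s, [])
  | s, l :: w => ((f ((runInv f s w).1, l)).1, (f ((runInv f s w).1, l)).2 :: (runInv f s w).2)

def runE {S : Type} (e : S × ℕ ≃ S × ℕ) : S × List ℕ ≃ S × List ℕ where
  toFun x := run e x.1 x.2
  invFun x := runInv e.symm x.1 x.2
  left_inv := by
    rintro ⟨s, w⟩
    induction w generalizing s with
    | nil => rfl
    | cons l w ih =>
      have := ih (e (s, l)).1
      simp only at this
      simp [run, runInv, this]
  right_inv := by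
    rintro ⟨s, w⟩
    induction w generalizing s with
    | nil => rfl
    | cons l w ih =>
      have := ih s
      simp only at this
      simp [run, runInv, this]

def wd (l : ℕ → ℕ) (N : ℕ) : List ℕ := (List.range N).map l

lemma run_concat {S : Type} (f : S × ℕ → S × ℕ) (s : S) (w : List ℕ) (l : ℕ) :
    run f s (w ++ [l]) = ((f ((run f s w).1, l)).1, (run f s w).2 ++ [(f ((run f s w).1, l)).2]) := by
  induction w generalizing s with
  | nil => rfl
  | cons a w ih => simp [run, ih]

lemma run_wd {S : Type} (f : S × ℕ → S × ℕ) (s : S) (l : ℕ → ℕ) (N : ℕ) :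
    run f s (wd l N) = (st f s l N, wd (out f s l) N) := by
  induction N with
  | zero => rfl
  | succ N ih =>
    simp only [wd, List.range_succ, List.map_append, List.map_cons, List.map_nil] at *
    rw [run_concat, ih]
    rfl

lemma run_length {S : Type} (f : S × ℕ → S × ℕ) (s : S) (w : List ℕ) :
    (run f s w).2.length = w.length := by
  induction w generalizing s with
  | nil => rfl
  | cons a w ih => simp [run, ih]

noncomputable def W (P : ℕ → ENNReal) (w : List ℕ) : ENNReal := (w.map P).prod

lemma wt_run {P : ℕ → ENNReal} {M : Mach} (hM : M.Good P) (s : M.S) (w : List ℕ) :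
    M.wt (run M.step s w).1 * W P (run M.step s w).2 = M.wt s * W P w := by
  induction w generalizing s with
  | nil => rfl
  | cons a w ih =>
    have h1 := ih (M.step (s, a)).1
    have h2 := hM.wt_step (s, a)
    simp only [W, run, List.map_cons, List.prod_cons] at *
    rw [mul_left_comm, h1, ← mul_assoc, mul_comm (P _), h2, mul_assoc]

lemma wd_eq_iff (l : ℕ → ℕ) (N : ℕ) (w : List ℕ) :
    wd l N = w ↔ w.length = N ∧ ∀ i < N, l i = w.getD i 0 := by
  constructor
  · rintro rfl
    refine ⟨by simp [wd], fun i hi => by simp [wd, hi]⟩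
  · rintro ⟨h, h'⟩
    apply List.ext_getElem
    · simp [wd, h]
    · intro i h1 h2
      have := h' i (by omega)
      simp [wd, this, h2]

lemma W_eq (P : ℕ → ENNReal) (w : List ℕ) :
    W P w = ∏ i ∈ Finset.range w.length, P (w.getD i 0) := by
  induction w with
  | nil => simp [W]
  | cons a w ih =>
    rw [List.length_cons, Finset.prod_range_succ']
    simp only [W, List.map_cons, List.prod_cons] at *
    rw [ih, mul_comm]
    simp

section prob
variable {Ω : Type*} [MeasurableSpace Ω] {μ : Measure Ω} {P : ℕ → ENNReal} {ξ : ℕ → Ω → ℕ}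

lemma wd_set (N : ℕ) (w : List ℕ) (h : w.length = N) :
    {ω | wd (fun m => ξ m ω) N = w} = ⋂ i ∈ Finset.range N, ξ i ⁻¹' {w.getD i 0} := by
  ext ω
  simp [wd_eq_iff, h]

lemma wd_meas (hmeas : ∀ m, Measurable (ξ m)) (N : ℕ) (w : List ℕ) :
    MeasurableSet {ω | wd (fun m => ξ m ω) N = w} := by
  by_cases h : w.length = N
  · rw [wd_set N w h]
    exact Finset.measurableSet_biInter _ (fun i _ => hmeas i (measurableSet_singleton _))
  · convert MeasurableSet.empty
    ext ω
    simp [wd_eq_iff, h]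

lemma wd_law (hindep : iIndepFun ξ μ) (hlaw : ∀ m i, μ {ω | ξ m ω = i} = P i)
    (N : ℕ) (w : List ℕ) :
    μ {ω | wd (fun m => ξ m ω) N = w} = if w.length = N then W P w else 0 := by
  split_ifs with h
  · rw [wd_set N w h, hindep.measure_inter_preimage_eq_mul (S := Finset.range N)
      (fun i _ => measurableSet_singleton _), W_eq, h]
    exact Finset.prod_congr rfl (fun i _ => hlaw i _)
  · convert measure_empty (μ := μ)
    ext ω
    simp [wd_eq_iff, h]

open Classical in
lemma wd_law_set (hmeas : ∀ m, Measurable (ξ m))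
    (hindep : iIndepFun ξ μ) (hlaw : ∀ m i, μ {ω | ξ m ω = i} = P i)
    (N : ℕ) (A : List ℕ → Prop) :
    μ {ω | A (wd (fun m => ξ m ω) N)} = ∑' w, if w.length = N ∧ A w then W P w else 0 := by
  have : {ω | A (wd (fun m => ξ m ω) N)} =
      ⋃ w, {ω | wd (fun m => ξ m ω) N = w ∧ A w} := by
    ext ω; simp
  rw [this, measure_iUnion]
  · congr 1
    funext w
    have := wd_law hindep hlaw N w
    by_cases hA : A w
    · simpa [hA] using this
    · simp [hA]
  · intro w w' hww
    rw [Function.onFun, Set.disjoint_left]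
    rintro ω ⟨h, -⟩ ⟨h', -⟩
    exact hww (h.symm.trans h')
  · intro w
    by_cases hA : A w
    · simpa [hA] using wd_meas hmeas N w
    · simp [hA]

lemma wd_meas_set (hmeas : ∀ m, Measurable (ξ m)) (N : ℕ) (A : List ℕ → Prop) :
    MeasurableSet {ω | A (wd (fun m => ξ m ω) N)} := by
  have : {ω | A (wd (fun m => ξ m ω) N)} =
      ⋃ w, {ω | wd (fun m => ξ m ω) N = w ∧ A w} := by
    ext ω; simp
  rw [this]
  refine MeasurableSet.iUnion (fun w => ?_)
  by_cases hA : A w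
  · simpa [hA] using wd_meas hmeas N w
  · simp [hA]

open Classical in
lemma burke {M : Mach} (hM : M.Good P) (hmeas : ∀ m, Measurable (ξ m))
    (hindep : iIndepFun ξ μ) (hlaw : ∀ m i, μ {ω | ξ m ω = i} = P i)
    (N : ℕ) (E : List ℕ → Prop) :
    μ {ω | E (wd (out M.step M.zero (fun m => ξ m ω)) N)} =
    ∑' s, M.wt s * μ {ω | E (wd (fun m => ξ m ω) N) ∧
      ((runE M.step).symm (s, wd (fun m => ξ m ω) N)).1 = M.zero} := by
  have h1 : ∀ s, μ {ω | E (wd (fun m => ξ m ω) N) ∧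
      ((runE M.step).symm (s, wd (fun m => ξ m ω) N)).1 = M.zero} =
      ∑' w, if w.length = N ∧ (E w ∧ ((runE M.step).symm (s, w)).1 = M.zero)
        then W P w else 0 := fun s => by
    convert wd_law_set hmeas hindep hlaw N
          (fun w => E w ∧ ((runE M.step).symm (s, w)).1 = M.zero)
  have h2 : μ {ω | E (wd (out M.step M.zero (fun m => ξ m ω)) N)} =
      ∑' w, if w.length = N ∧ E (run M.step M.zero w).2 then W P w else 0 := by
    rw [← wd_law_set hmeas hindep hlaw N (fun w => E (run M.step M.zero w).2)]
    simp_rw [run_wd]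
  simp_rw [h1, h2, ← ENNReal.tsum_mul_left]
  rw [← ENNReal.tsum_prod' (f := fun x : M.S × List ℕ => M.wt x.1 *
    (if x.2.length = N ∧ (E x.2 ∧ ((runE M.step).symm x).1 = M.zero)
        then W P x.2 else 0)), ← (runE M.step).tsum_eq, ENNReal.tsum_prod',
        tsum_eq_single M.zero]
  · congr 1
    funext w
    rw [Equiv.symm_apply_apply]
    change _ = M.wt (run M.step M.zero w).1 * (if (run M.step M.zero w).2.length = N ∧
      (E (run M.step M.zero w).2 ∧ M.zero = M.zero) then W P (run M.step M.zero w).2 else 0)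
    rw [run_length]
    have := wt_run hM M.zero w
    rw [hM.wt_zero, one_mul] at this
    by_cases h : w.length = N ∧ E (run M.step M.zero w).2
    · simp [h, this]
    · rw [if_neg h, if_neg (by tauto), mul_zero]
  · intro s hs
    rw [ENNReal.tsum_eq_zero]
    intro w
    rw [Equiv.symm_apply_apply, if_neg, mul_zero]
    rintro ⟨-, -, h⟩
    exact hs h

/-- letters from a list -/
def ext (w : List ℕ) (i : ℕ) : ℕ := w.getD i 0

lemma ext_wd (l : ℕ → ℕ) {N i : ℕ} (h : i < N) : ext (wd l N) i = l i := by
  simp [ext, wd, h]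

lemma wd_ext (w : List ℕ) : wd (ext w) w.length = w := by
  rw [wd_eq_iff]; exact ⟨rfl, fun i _ => rfl⟩

/-- deterministic description of the event that the backward machine ends empty -/
lemma back_traj (M : Mach) (s' : M.S) (z : ℕ → ℕ) (N : ℕ) :
    ∃ l : ℕ → ℕ, st M.step ((runE M.step).symm (s', wd z N)).1 l N = s' ∧
      ∀ i < N, out M.step ((runE M.step).symm (s', wd z N)).1 l i = z i := by
  set x := (runE M.step).symm (s', wd z N) with hx
  have h : run M.step x.1 x.2 = (s', wd z N) := (runE M.step).apply_symm_apply _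
  have hl : x.2.length = N := by
    have := run_length M.step x.1 x.2
    rw [h] at this
    simpa [wd] using this.symm
  refine ⟨ext x.2, ?_⟩
  have h3 := run_wd M.step x.1 (ext x.2) x.2.length
  rw [wd_ext, h, hl, Prod.mk.injEq] at h3
  refine ⟨h3.1.symm, fun i hi => ?_⟩
  have := congrArg (fun w => ext w i) h3.2
  simpa [ext_wd, hi] using this.symm

lemma back_iff (P : ℕ → ENNReal) (k : ℕ) (s' : (tri P 0 k).S) (z : ℕ → ℕ)
    (hz : ∀ i, i + 1 < k → Filter.Tendsto (fun N => cnt z (i+1) N - cnt z i N)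
      Filter.atTop Filter.atTop) :
    ∀ᶠ N in Filter.atTop, (((runE (tri P 0 k).step).symm (s', wd z N)).1 = (tri P 0 k).zero ↔
      ∀ j, ∀ i, i + 1 < k → cnt z i j ≤ cnt z (i+1) j) := by
  by_cases hW : ∀ j, ∀ i, i + 1 < k → cnt z i j ≤ cnt z (i+1) j
  · have : ∀ᶠ N in Filter.atTop, ∀ i ∈ Finset.range (k-1),
        ((tri P 0 k).size s' : ℤ) ≤ cnt z (i+1) N - cnt z i N := by
      rw [Filter.eventually_all_finset]
      intro i hi
      exact (hz i (by simp at hi; omega)).eventually_ge_atTop _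
    filter_upwards [this] with N hN
    refine iff_of_true ?_ hW
    obtain ⟨l, h1, h2⟩ := back_traj (tri P 0 k) s' z N
    have hc : ∀ i, ∀ u ≤ N, cnt (out (tri P 0 k).step
      ((runE (tri P 0 k).step).symm (s', wd z N)).1 l) i u = cnt z i u :=
      fun i u hu => cnt_congr (fun m hm => h2 m (by omega)) i
    apply tri_back P N k 0 _ l
    · intro i hi u hu
      rw [hc _ u hu, hc _ u hu]
      simpa using hW u i hi
    · intro i hi
      rw [hc _ N le_rfl, hc _ N le_rfl, h1]
      have := hN i (by simp; omega)
      simp only [Nat.zero_add]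
      linarith
  · have hW' := hW
    push Not at hW
    obtain ⟨j, i, hi, hlt⟩ := hW
    filter_upwards [Filter.eventually_ge_atTop j] with N hN
    refine iff_of_false ?_ hW'
    intro h0
    obtain ⟨l, h1, h2⟩ := back_traj (tri P 0 k) s' z N
    rw [h0] at h2
    have := tri_fwd P k 0 l i j hi
    rw [cnt_congr (fun m hm => h2 m (by omega)), cnt_congr (fun m hm => h2 m (by omega))] at this
    simp only [Nat.zero_add] at this
    omega

lemma cnt_meas (hmeas : ∀ m, Measurable (ξ m)) (i n : ℕ) :
    Measurable (fun ω => cnt (fun m => ξ m ω) i n) := by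
  induction n with
  | zero => simp only [cnt_zero]; exact measurable_const
  | succ n ih =>
    simp only [cnt_succ]
    exact ih.add (Measurable.ite (hmeas n (measurableSet_singleton i)) measurable_const
      measurable_const)

lemma key [IsProbabilityMeasure μ] (k : ℕ) (hG : (tri P 0 k).Good P)
    (hmeas : ∀ m, Measurable (ξ m))
    (hindep : iIndepFun ξ μ) (hlaw : ∀ m i, μ {ω | ξ m ω = i} = P i)
    (hdrift : ∀ᵐ ω ∂μ, ∀ i, i + 1 < k → Filter.Tendsto
      (fun N => cnt (fun m => ξ m ω) (i+1) N - cnt (fun m => ξ m ω) i N)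
      Filter.atTop Filter.atTop)
    (n : ℕ) (g : ℕ → ℕ → ℤ) :
    μ {ω | ∀ m ≤ n, ∀ i, i < k → G k (fun i' n' => cnt (fun m => ξ m ω) i' n') i m = g i m} =
    (∑' s, (tri P 0 k).wt s) * μ {ω | (∀ m ≤ n, ∀ i, i < k → cnt (fun m => ξ m ω) i m = g i m) ∧
      ∀ j, ∀ i, i + 1 < k → cnt (fun m => ξ m ω) i j ≤ cnt (fun m => ξ m ω) (i+1) j} := by
  set M := tri P 0 k with hM
  set E : List ℕ → Prop := fun w => ∀ m ≤ n, ∀ i, i < k → cnt (ext w) i m = g i m with hE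
  have hEw : ∀ (z : ℕ → ℕ) N, n ≤ N → (E (wd z N) ↔ ∀ m ≤ n, ∀ i, i < k → cnt z i m = g i m) := by
    intro z N hN
    simp only [hE]
    refine forall₂_congr fun m hm => forall₂_congr fun i hi => ?_
    rw [cnt_congr (fun r hr => ext_wd z (show r < N by omega))]
  have hL : ∀ N, n ≤ N → {ω | ∀ m ≤ n, ∀ i, i < k →
      G k (fun i' n' => cnt (fun m => ξ m ω) i' n') i m = g i m} =
      {ω | E (wd (out M.step M.zero (fun m => ξ m ω)) N)} := by
    intro N hN
    ext ω
    simp only [Set.mem_ofPred_eq]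
    rw [hEw _ N hN]
    refine forall₂_congr fun m hm => forall₂_congr fun i hi => ?_
    have := congrFun (tri_G P k 0 (fun m => ξ m ω) i hi) m
    simp only [Nat.zero_add] at this
    rw [← this]
  set F := {ω | (∀ m ≤ n, ∀ i, i < k → cnt (fun m => ξ m ω) i m = g i m) ∧
      ∀ j, ∀ i, i + 1 < k → cnt (fun m => ξ m ω) i j ≤ cnt (fun m => ξ m ω) (i+1) j} with hF
  set A : M.S → ℕ → Set Ω := fun s N => {ω | E (wd (fun m => ξ m ω) N) ∧
      ((runE M.step).symm (s, wd (fun m => ξ m ω) N)).1 = M.zero} with hA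
  have hAm : ∀ s N, MeasurableSet (A s N) := fun s N => wd_meas_set hmeas N
    (fun w => E w ∧ ((runE M.step).symm (s, w)).1 = M.zero)
  have hFm : MeasurableSet F := by
    have h1 : F = (⋂ m, ⋂ (_ : m ≤ n), ⋂ i, ⋂ (_ : i < k),
        {ω | cnt (fun m => ξ m ω) i m = g i m}) ∩ ⋂ j, ⋂ i, ⋂ (_ : i + 1 < k),
        {ω | cnt (fun m => ξ m ω) i j ≤ cnt (fun m => ξ m ω) (i+1) j} := by
      ext ω; simp [hF]
    rw [h1]
    refine MeasurableSet.inter ?_ ?_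
    · refine MeasurableSet.iInter fun m => MeasurableSet.iInter fun _ =>
        MeasurableSet.iInter fun i => MeasurableSet.iInter fun _ => ?_
      exact measurableSet_eq_fun (cnt_meas hmeas i m) measurable_const
    · refine MeasurableSet.iInter fun m => MeasurableSet.iInter fun i =>
        MeasurableSet.iInter fun _ => ?_
      exact measurableSet_le (cnt_meas hmeas i m) (cnt_meas hmeas (i+1) m)
  have hlim : ∀ s, Filter.Tendsto (fun N => μ (A s N)) Filter.atTop (nhds (μ F)) := by
    intro s
    have hae : ∀ᵐ ω ∂μ, ∀ᶠ N in Filter.atTop, ω ∈ A s N ↔ ω ∈ F := by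
      filter_upwards [hdrift] with ω hω
      filter_upwards [back_iff P k s _ hω, Filter.eventually_ge_atTop n] with N h1 h2
      simp only [hA, hF, Set.mem_ofPred_eq]
      rw [hEw _ N h2, h1]
    exact tendsto_measure_of_ae_tendsto_indicator_of_isFiniteMeasure _ hFm (hAm s) hae
  have hconv : Filter.Tendsto (fun N => ∑' s, M.wt s * μ (A s N)) Filter.atTop
      (nhds (∑' s, M.wt s * μ F)) := by
    letI : MeasurableSpace M.S := ⊤
    have : ∀ f : M.S → ENNReal, ∑' s, f s = ∫⁻ s, f s ∂Measure.count :=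
      fun f => (lintegral_count f).symm
    simp_rw [this]
    refine tendsto_lintegral_of_dominated_convergence M.wt (fun N => measurable_from_top)
      (fun N => Filter.Eventually.of_forall fun s => ?_) ?_
      (Filter.Eventually.of_forall fun s => ?_)
    · exact mul_le_of_le_one_right' prob_le_one
    · rw [← this]; exact hG.wt_sum
    · exact ENNReal.Tendsto.const_mul (hlim s) (Or.inr (ENNReal.ne_top_of_tsum_ne_top hG.wt_sum s))
  rw [ENNReal.tsum_mul_right] at hconv
  refine tendsto_nhds_unique (tendsto_const_nhds.congr' ?_) hconv
  filter_upwards [Filter.eventually_ge_atTop n] with N hN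
  rw [hL N hN]
  exact burke hG hmeas hindep hlaw N E

end prob

lemma drift {Ω : Type*} [MeasurableSpace Ω] {μ : Measure Ω} [IsProbabilityMeasure μ]
    {ξ : ℕ → Ω → ℕ} {P : ℕ → ENNReal}
    (hmeas : ∀ m, Measurable (ξ m))
    (hindep : iIndepFun ξ μ) (hlaw : ∀ m i, μ {ω | ξ m ω = i} = P i)
    (a b : ℕ) (hab : P a < P b) :
    ∀ᵐ ω ∂μ, Filter.Tendsto
      (fun N => cnt (fun m => ξ m ω) b N - cnt (fun m => ξ m ω) a N)
      Filter.atTop Filter.atTop := by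
  set f : ℕ → ℝ := fun x => (if x = b then 1 else 0) - (if x = a then 1 else 0) with hf
  have hfm : Measurable f := measurable_from_top
  have hid : ∀ i, IdentDistrib (ξ i) (ξ 0) μ μ := by
    intro i
    refine ⟨(hmeas i).aemeasurable, (hmeas 0).aemeasurable, ?_⟩
    refine Measure.ext_of_singleton fun x => ?_
    rw [Measure.map_apply (hmeas i) (measurableSet_singleton x),
      Measure.map_apply (hmeas 0) (measurableSet_singleton x)]
    exact (hlaw i x).trans (hlaw 0 x).symm
  have hI : ∀ x, Integrable (fun ω => if ξ 0 ω = x then (1:ℝ) else 0) μ ∧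
      ∫ ω, (if ξ 0 ω = x then (1:ℝ) else 0) ∂μ = (P x).toReal := by
    intro x
    have hs : MeasurableSet {ω | ξ 0 ω = x} := hmeas 0 (measurableSet_singleton x)
    have e : (fun ω => if ξ 0 ω = x then (1:ℝ) else 0) =
        Set.indicator {ω | ξ 0 ω = x} (fun _ => (1:ℝ)) := by
      funext ω; simp [Set.indicator_apply]
    rw [e]
    refine ⟨(integrable_const 1).indicator hs, ?_⟩
    rw [integral_indicator_const _ hs]
    simp [Measure.real, hlaw]
  have hsl := strong_law_ae_real (μ := μ) (fun m ω => f (ξ m ω))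
    ((hI b).1.sub (hI a).1)
    (fun i j hij => (hindep.indepFun hij).comp hfm hfm)
    (fun i => (hid i).comp hfm)
  have hmean : ∫ ω, f (ξ 0 ω) ∂μ = (P b).toReal - (P a).toReal := by
    simp only [hf]
    rw [integral_sub (hI b).1 (hI a).1, (hI b).2, (hI a).2]
  have hPb : P b ≠ ⊤ := by rw [← hlaw 0 b]; exact measure_ne_top _ _
  have hpos : 0 < (P b).toReal - (P a).toReal := by
    have := (ENNReal.toReal_lt_toReal (ne_top_of_lt hab) hPb).2 hab
    linarith
  filter_upwards [hsl] with ω hω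
  rw [hmean] at hω
  have hs : ∀ N, ∑ i ∈ Finset.range N, f (ξ i ω) =
      ((cnt (fun m => ξ m ω) b N - cnt (fun m => ξ m ω) a N : ℤ) : ℝ) := by
    intro N
    induction N with
    | zero => simp [cnt_zero]
    | succ N ih =>
      rw [Finset.sum_range_succ, ih, cnt_succ, cnt_succ]
      simp only [hf]
      push_cast
      ring
  have h2 := Filter.Tendsto.pos_mul_atTop hpos hω tendsto_natCast_atTop_atTop
  rw [← tendsto_intCast_atTop_iff (R := ℝ)]
  refine h2.congr' ?_
  filter_upwards [Filter.eventually_gt_atTop 0] with N hN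
  rw [← hs, div_mul_cancel₀]
  exact_mod_cast hN.ne'

end GW

/-- assuming `p_1 < ⋯ < p_k`, the transformed walk `G^{(k)}(X)`
has the law of `X` conditioned never to exit the Weyl chamber `W`. -/
theorem stmt8 {Ω : Type*} [MeasureSpace Ω] [IsProbabilityMeasure (ℙ : Measure Ω)]
    (k : ℕ) (hk : 2 ≤ k) (p : ℕ → ℝ)
    (hp0 : ∀ i, i < k → 0 < p i)
    (hmono : ∀ i j, i < j → j < k → p i < p j)
    (hsum : ∑ i ∈ Finset.range k, p i = 1)
    (ξ : ℕ → Ω → ℕ) (hmeas : ∀ m, Measurable (ξ m))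
    (hindep : iIndepFun ξ ℙ)
    (hlaw : ∀ m i, i < k → ℙ {ω | ξ m ω = i} = ENNReal.ofReal (p i))
    (n : ℕ) (g : ℕ → ℕ → ℤ)
    (hg0 : ∀ i, i < k → g i 0 = 0)
    (hgstep : ∀ m, 1 ≤ m → m ≤ n →
      ∃ j, j < k ∧ g j m = g j (m-1) + 1 ∧ ∀ i, i < k → i ≠ j → g i m = g i (m-1))
    (hgW : ∀ m ≤ n, ∀ i, i + 1 < k → g i m ≤ g (i+1) m) :
    ℙ {ω | ∀ m ≤ n, ∀ i, i < k → G k (fun i' n' => Xcnt ξ i' n' ω) i m = g i m}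
      * ℙ {ω | ∀ j, ∀ i, i + 1 < k → Xcnt ξ i j ω ≤ Xcnt ξ (i+1) j ω}
    = ℙ {ω | (∀ m ≤ n, ∀ i, i < k → Xcnt ξ i m ω = g i m) ∧
        (∀ j, ∀ i, i + 1 < k → Xcnt ξ i j ω ≤ Xcnt ξ (i+1) j ω)} := by
  classical
  set P : ℕ → ENNReal := fun i => if i < k then ENNReal.ofReal (p i) else 0 with hP
  have hlawP : ∀ m i, ℙ {ω | ξ m ω = i} = P i := by
    intro m i
    by_cases hi : i < k
    · simp only [hP, hi, if_true]; exact hlaw m i hi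
    · simp only [hP, hi, if_false]
      have h1 : ℙ {ω | ξ m ω < k} = 1 := by
        have e : {ω | ξ m ω < k} = ⋃ i ∈ Finset.range k, {ω | ξ m ω = i} := by
          ext ω; simp
        rw [e, measure_biUnion_finset]
        · rw [Finset.sum_congr rfl (fun i hi => hlaw m i (Finset.mem_range.1 hi)),
            ← ENNReal.ofReal_sum_of_nonneg (fun i hi => (hp0 i (Finset.mem_range.1 hi)).le),
            hsum, ENNReal.ofReal_one]
        · intro i _ j _ hij
          rw [Function.onFun, Set.disjoint_left]
          intro ω h h'
          exact hij (Eq.trans (Eq.symm h) h')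
        · intro i _
          exact hmeas m (measurableSet_singleton i)
      have hms : MeasurableSet {ω | ξ m ω < k} := hmeas m (measurableSet_Iio (a := k))
      have h2 := prob_compl_eq_zero_iff (μ := (ℙ : Measure Ω)) hms |>.2 h1
      refine measure_mono_null ?_ h2
      intro ω (hω : ξ m ω = i) (h : ξ m ω < k)
      omega
  have hPlt : ∀ i j, i < j → j < k → P i < P j ∧ P j ≠ ⊤ := by
    intro i j hij hj
    simp only [hP, hj, hij.trans hj, if_true]
    exact ⟨(ENNReal.ofReal_lt_ofReal_iff (hp0 j hj)).2 (hmono i j hij hj), ENNReal.ofReal_ne_top⟩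
  have hG := GW.good_tri hPlt k 0 (by omega)
  have hdrift : ∀ᵐ ω ∂(ℙ : Measure Ω), ∀ i, i + 1 < k → Filter.Tendsto
      (fun N => GW.cnt (fun m => ξ m ω) (i+1) N - GW.cnt (fun m => ξ m ω) i N)
      Filter.atTop Filter.atTop := by
    rw [ae_all_iff]
    intro i
    by_cases hi : i + 1 < k
    · filter_upwards [GW.drift hmeas hindep hlawP i (i+1) (hPlt i (i+1) (by omega) hi).1]
        with ω hω _
      exact hω
    · exact Filter.Eventually.of_forall fun ω h => absurd h hi
  have h1 := GW.key k hG hmeas hindep hlawP hdrift n g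
  have h0 := GW.key k hG hmeas hindep hlawP hdrift 0 (fun _ _ => 0)
  have e1 : {ω | ∀ m ≤ 0, ∀ i, i < k →
      G k (fun i' n' => GW.cnt (fun m => ξ m ω) i' n') i m = 0} = Set.univ := by
    ext ω
    simp only [Set.mem_ofPred_eq, Set.mem_univ, iff_true]
    intro m hm i hi
    obtain rfl : m = 0 := by omega
    have := congrFun (GW.tri_G P k 0 (fun m => ξ m ω) i hi) 0
    simp only [Nat.zero_add] at this
    rw [← this, GW.cnt_zero]
  have e2 : {ω | (∀ m ≤ 0, ∀ i, i < k → GW.cnt (fun m => ξ m ω) i m = 0) ∧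
      ∀ j, ∀ i, i + 1 < k → GW.cnt (fun m => ξ m ω) i j ≤ GW.cnt (fun m => ξ m ω) (i+1) j} =
      {ω | ∀ j, ∀ i, i + 1 < k →
        GW.cnt (fun m => ξ m ω) i j ≤ GW.cnt (fun m => ξ m ω) (i+1) j} := by
    ext ω
    simp only [Set.mem_ofPred_eq, and_iff_right_iff_imp]
    intro _ m hm i hi
    obtain rfl : m = 0 := by omega
    exact GW.cnt_zero _ _
  rw [e1, e2, measure_univ] at h0
  change ℙ {ω | ∀ m ≤ n, ∀ i, i < k →
      G k (fun i' n' => GW.cnt (fun m => ξ m ω) i' n') i m = g i m} *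
    ℙ {ω | ∀ j, ∀ i, i + 1 < k →
        GW.cnt (fun m => ξ m ω) i j ≤ GW.cnt (fun m => ξ m ω) (i+1) j} =
    ℙ {ω | (∀ m ≤ n, ∀ i, i < k → GW.cnt (fun m => ξ m ω) i m = g i m) ∧
      ∀ j, ∀ i, i + 1 < k → GW.cnt (fun m => ξ m ω) i j ≤ GW.cnt (fun m => ξ m ω) (i+1) j}
  rw [h1, mul_right_comm, ← h0, one_mul]
end

section
/- Assume 0<p_1<p_2<⋯<p_k with ∑_i p_i=1. Then there is a constant C>0, independent of x, such that for every x∈W∩ℤ_+^k, the walk started at x satisfies P(x+X(n)∈W for all n≥0) = C·p^{−x}·s_{x^*}(p). -/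
open MeasureTheory ProbabilityTheory

/-- The cells of the Young diagram of shape `lam` (row lengths), within the
first `k` rows. -/
def cells (k : ℕ) (lam : ℕ → ℕ) : Finset (ℕ × ℕ) :=
  (Finset.range k ×ˢ Finset.range ((Finset.range k).sup lam)).filter
    (fun rc => rc.2 < lam rc.1)

/-- `T` is a semistandard Young tableau of shape `lam` with entries in
`{0,…,k-1}` (0-based version of entries `{1,…,k}`): rows weakly increase,
columns strictly increase, and `T` vanishes outside the diagram. -/
def IsSSYT (k : ℕ) (lam : ℕ → ℕ) (T : ℕ → ℕ → ℕ) : Prop :=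
  (∀ r c, c < lam r → T r c < k) ∧
  (∀ r c, ¬ c < lam r → T r c = 0) ∧
  (∀ r c c', c ≤ c' → c' < lam r → T r c ≤ T r c') ∧
  (∀ r r' c, r < r' → c < lam r' → T r c < T r' c)

/-- Number of entries of `T` (of shape `lam`, within `k` rows) equal to `i`. -/
def entryCount (k : ℕ) (lam : ℕ → ℕ) (T : ℕ → ℕ → ℕ) (i : ℕ) : ℕ :=
  ((cells k lam).filter (fun rc => T rc.1 rc.2 = i)).card

/-- The Schur polynomial `s_lam(p) = ∑_T p^{weight(T)}`, summing over all
semistandard tableaux of shape `lam` with entries in `{0,…,k-1}`. -/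
noncomputable def schur (k : ℕ) (lam : ℕ → ℕ) (p : ℕ → ℝ) : ℝ :=
  ∑' T : {T : ℕ → ℕ → ℕ // IsSSYT k lam T},
    ∏ i ∈ Finset.range k, p i ^ entryCount k lam T.1 i

/-- The reversed vector `x^*` of `x ∈ ℤ_+^k`, as a shape (`lam j = x_{k-1-j}`
for `j < k`, `0` otherwise). -/
def revPart (k : ℕ) (x : ℕ → ℕ) : ℕ → ℕ :=
  fun j => if j < k then x (k-1-j) else 0

noncomputable def altS (k : ℕ) (p : ℕ → ℝ) (x : ℕ → ℕ) : ℝ :=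
  Matrix.det (Matrix.of fun i j : Fin k => p i ^ (x j + j))

def extz (k : ℕ) (y : Fin k → ℕ) : ℕ → ℕ := fun n => if h : n < k then y ⟨n, h⟩ else 0

lemma geom_aux (a b : ℝ) (m n e : ℕ) (h : m ≤ n) :
    a ^ (n + 1 + e) - b ^ (n + 1 - m) * a ^ (m + e)
      = (a - b) * ∑ y ∈ Finset.Icc m n, b ^ (n - y) * a ^ (y + e) := by
  induction n, h using Nat.le_induction with
  | base => simp; ring
  | succ n hmn ih =>
    rw [Finset.sum_Icc_succ_top (by omega), add_comm (Finset.sum _ _)]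
    have : ∑ y ∈ Finset.Icc m n, b ^ (n + 1 - y) * a ^ (y + e) =
        b * ∑ y ∈ Finset.Icc m n, b ^ (n - y) * a ^ (y + e) := by
      rw [Finset.mul_sum]
      refine Finset.sum_congr rfl fun y hy => ?_
      rw [Finset.mem_Icc] at hy
      rw [show n + 1 - y = (n - y) + 1 by omega]; ring
    rw [this, mul_add, mul_left_comm (a - b) b, ← ih, show n + 1 + 1 - m = (n + 1 - m) + 1 by omega]
    simp
    ring

lemma altS_succ (k : ℕ) (p : ℕ → ℝ) (x : ℕ → ℕ) (hx : ∀ j, j < k → x j ≤ x (j + 1)) :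
    altS (k + 1) p x = (∏ i : Fin k, (p k - p i)) *
      ∑ y ∈ Fintype.piFinset (fun j : Fin k => Finset.Icc (x j) (x (j + 1))),
        (p k ^ (x 0) * ∏ j : Fin k, p k ^ (x (j + 1) - y j)) * altS k p (extz k y) := by
  set B : Matrix (Fin (k + 1)) (Fin (k + 1)) ℝ := Matrix.of fun i j =>
    Fin.cases (p i ^ (x 0))
      (fun j' : Fin k => p i ^ (x (j' + 1) + 1 + j')
        - p k ^ (x (j' + 1) + 1 - x j') * p i ^ (x j' + j')) j with hB
  have h1 : altS (k + 1) p x = B.det := by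
    unfold altS
    refine Matrix.det_eq_of_forall_col_eq_smul_add_pred
      (fun j => p k ^ (x (j + 1) + 1 - x j)) ?_ ?_
    · intro i; simp [hB]
    · intro i j
      simp [hB, add_assoc, add_comm]
  have hlast : ∀ j : Fin k, B (Fin.last k) j.succ = 0 := by
    intro j
    have := hx j j.2
    simp only [hB, Matrix.of_apply, Fin.cases_succ, Fin.val_last]
    rw [← pow_add, show x (j + 1) + 1 - x j + (x j + j) = x (j + 1) + 1 + j by omega, sub_self]
  have hmin : B.submatrix (Fin.last k).succAbove (Fin.succAbove 0) =
      Matrix.of fun i j : Fin k => (p i - p k) *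
        (∑ y ∈ Finset.Icc (x j) (x (j + 1)), p k ^ (x (j + 1) - y) * p i ^ (y + j)) := by
    ext i j
    simp only [hB, Matrix.submatrix_apply, Matrix.of_apply, Fin.zero_succAbove, Fin.cases_succ,
      Fin.succAbove_last, Fin.val_castSucc]
    exact geom_aux _ _ _ _ _ (hx j j.2)
  rw [h1, Matrix.det_succ_row _ (Fin.last k), Fin.sum_univ_succ]
  simp only [hlast, mul_zero, zero_mul, Finset.sum_const_zero, add_zero]
  rw [hmin]
  have h2 := Matrix.det_mul_column (fun i : Fin k => p i - p k) (Matrix.of fun i j : Fin k => 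
        (∑ y ∈ Finset.Icc (x j) (x (j + 1)), p k ^ (x (j + 1) - y) * p i ^ (y + j)))
  simp only [Matrix.of_apply] at h2
  rw [h2]
  have h3 : (∏ i : Fin k, (p k - p i)) = (-1) ^ k * ∏ i : Fin k, (p i - p k) := by
    have : ∀ i : Fin k, p k - p i = (-1) * (p i - p k) := fun i => by ring
    simp_rw [this, Finset.prod_mul_distrib]; simp
  have h4 : (Matrix.of fun i j : Fin k => 
        (∑ y ∈ Finset.Icc (x j) (x (j + 1)), p k ^ (x (j + 1) - y) * p i ^ (y + j))).det
      = ∑ y ∈ Fintype.piFinset (fun j : Fin k => Finset.Icc (x j) (x (j + 1))),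
        (∏ j : Fin k, p k ^ (x (j + 1) - y j)) * altS k p (extz k y) := by
    rw [← Matrix.det_transpose]
    have h5 := MultilinearMap.map_sum_finset
      (Matrix.detRowAlternating (n := Fin k) (R := ℝ)).toMultilinearMap
      (fun (j : Fin k) (y : ℕ) => fun i : Fin k => p k ^ (x (j + 1) - y) * p i ^ (y + j))
      (fun j : Fin k => Finset.Icc (x j) (x (j + 1)))
    have h6 : (Matrix.of fun i j : Fin k => 
        (∑ y ∈ Finset.Icc (x j) (x (j + 1)), p k ^ (x (j + 1) - y) * p i ^ (y + j))).transpose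
       = fun j : Fin k => ∑ y ∈ Finset.Icc (x j) (x (j + 1)),
          (fun i : Fin k => p k ^ (x (j + 1) - y) * p i ^ (y + j)) := by
      ext i j; simp [Finset.sum_apply]
    rw [h6]
    refine h5.trans ?_
    refine Finset.sum_congr rfl fun y _ => ?_
    rw [altS, ← Matrix.det_transpose, ← Matrix.det_mul_column]
    change Matrix.det _ = Matrix.det _
    congr 1
    ext i j
    simp [extz]
  rw [h4, h3, Finset.mul_sum, Finset.mul_sum, Finset.mul_sum]
  refine Finset.sum_congr rfl fun y _ => ?_
  simp [hB]
  ring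

/-- glue -/
def glueT (k : ℕ) (lam mu : ℕ → ℕ) (T : ℕ → ℕ → ℕ) : ℕ → ℕ → ℕ :=
  fun r c => if c < mu r then T r c else if c < lam r then k else 0

lemma glue_ssyt (k : ℕ) (lam mu : ℕ → ℕ) (T : ℕ → ℕ → ℕ) (h1 : ∀ r, mu r ≤ lam r)
    (h2 : ∀ r, lam (r + 1) ≤ mu r) (hT : IsSSYT k mu T) :
    IsSSYT (k + 1) lam (glueT k lam mu T) := by
  obtain ⟨a, b, c, d⟩ := hT
  have hanti : Antitone lam := antitone_nat_of_succ_le fun r => (h2 r).trans (h1 r)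
  refine ⟨?_, ?_, ?_, ?_⟩
  · intro r s hs
    unfold glueT
    split_ifs with h
    · exact (a r s h).trans (Nat.lt_succ_self k)
    · omega
  · intro r s hs
    have := h1 r
    unfold glueT
    rw [if_neg (by omega), if_neg hs]
  · intro r s s' hs hs'
    unfold glueT
    by_cases h : s' < mu r
    · rw [if_pos (by omega), if_pos h]; exact c r s s' hs h
    · rw [if_neg h, if_pos hs']
      split_ifs with h'
      · exact (a r s h').le
      · exact le_rfl
      · omega
  · intro r r' s hr hs
    have h3 : lam r' ≤ lam (r + 1) := hanti hr
    have h4 := h2 r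
    unfold glueT
    rw [if_pos (by omega : s < mu r)]
    split_ifs with h
    · exact d r r' s hr h
    · exact a r s (by omega)

lemma glue_surj (k : ℕ) (lam : ℕ → ℕ) (hanti : Antitone lam)
    (T : ℕ → ℕ → ℕ) (hT : IsSSYT (k + 1) lam T) :
    ∃ mu T', (∀ r, mu r ≤ lam r) ∧ (∀ r, lam (r + 1) ≤ mu r) ∧ (∀ r, k ≤ r → mu r = 0) ∧
      IsSSYT k mu T' ∧ glueT k lam mu T' = T := by
  obtain ⟨a, b, c, d⟩ := hT
  have hmu : ∀ r, ∃ m, m ≤ lam r ∧ ∀ s, s < lam r → (s < m ↔ T r s < k) := by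
    intro r
    by_cases h : ∃ s, s < lam r ∧ ¬ T r s < k
    · classical
      refine ⟨Nat.find h, (Nat.find_spec h).1.le, ?_⟩
      intro s hs
      constructor
      · intro h'
        have := Nat.find_min h h'
        tauto
      · intro h'
        by_contra h''
        have h3 := (Nat.find_spec h).2
        have := c r (Nat.find h) s (by omega) hs
        omega
    · push Not at h
      exact ⟨lam r, le_rfl, fun s hs => by simp [hs, h s hs]⟩
  choose mu hm1 hm2 using hmu
  have hge : ∀ r s, s < lam r → r ≤ T r s := by
    intro r
    induction r with
    | zero => intros; omega
    | succ r ih =>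
      intro s hs
      have := ih s (lt_of_lt_of_le hs (hanti (Nat.le_succ r)))
      have := d r (r + 1) s (Nat.lt_succ_self r) hs
      omega
  have h2 : ∀ r, lam (r + 1) ≤ mu r := by
    intro r
    by_contra h
    push Not at h
    have h3 := d r (r + 1) (mu r) (Nat.lt_succ_self r) h
    have h4 := a (r + 1) _ h
    have h5 := (hm2 r (mu r) (lt_of_lt_of_le h (hanti (Nat.le_succ r))))
    omega
  refine ⟨mu, fun r s => if s < mu r then T r s else 0, hm1, h2, ?_, ⟨?_, ?_, ?_, ?_⟩, ?_⟩
  · intro r hr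
    by_contra h
    have h6 := hm1 r
    have h3 := hge r 0 (by omega)
    have h4 := (hm2 r 0 (by omega)).1 (by omega)
    omega
  · intro r s hs
    have h6 := hm1 r
    simp only [hs, if_true]
    exact (hm2 r s (by omega)).1 hs
  · intro r s hs
    simp [hs]
  · intro r s s' hs hs'
    have h6 := hm1 r
    simp only [hs', if_true, lt_of_le_of_lt hs hs']
    exact c r s s' hs (by omega)
  · intro r r' s hr hs
    have h6 := hm1 r'
    have h7 : s < mu r := by
      have := h2 r
      have := hanti (Nat.succ_le_of_lt hr)
      simp at this
      omega
    simp only [hs, if_true, h7]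
    exact d r r' s hr (by omega)
  · ext r s
    have h6 := hm1 r
    unfold glueT
    split_ifs with h h'
    · simp [h]
    · have := hm2 r s h'
      have := a r s h'
      omega
    · exact (b r s h').symm

lemma glue_inj_mu (k : ℕ) (lam mu mu' : ℕ → ℕ) (T T' : ℕ → ℕ → ℕ) (h1 : ∀ r, mu r ≤ lam r)
    (h1' : ∀ r, mu' r ≤ lam r) (hT : IsSSYT k mu T) (hT' : IsSSYT k mu' T')
    (h : glueT k lam mu T = glueT k lam mu' T') : mu = mu' ∧ T = T' := by
  have key : ∀ (nu : ℕ → ℕ) (S : ℕ → ℕ → ℕ), (∀ r, nu r ≤ lam r) → IsSSYT k nu S →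
      ∀ r s, s < nu r ↔ (s < lam r ∧ glueT k lam nu S r s < k) := by
    intro nu S hn hS r s
    have := hn r
    have := hS.1 r s
    unfold glueT
    split_ifs with h h' <;> omega
  have hmu : mu = mu' := by
    ext r
    have h3 : ∀ s, s < mu r ↔ s < mu' r := fun s => by
      rw [key mu T h1 hT, key mu' T' h1' hT', h]
    have := h3 (mu r)
    have := h3 (mu' r)
    omega
  subst hmu
  refine ⟨rfl, ?_⟩
  ext r s
  have h3 := congrFun (congrFun h r) s
  unfold glueT at h3
  by_cases hs : s < mu r
  · simpa [hs] using h3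
  · rw [hT.2.1 r s hs, hT'.2.1 r s hs]

lemma entryCount_eq (k : ℕ) (lam : ℕ → ℕ) (T : ℕ → ℕ → ℕ) (i : ℕ) :
    entryCount k lam T i =
      ∑ r ∈ Finset.range k, ((Finset.range (lam r)).filter (fun s => T r s = i)).card := by
  unfold entryCount cells
  rw [← Finset.card_sigma]
  refine Finset.card_bij (fun rc _ => ⟨rc.1, rc.2⟩) ?_ ?_ ?_
  · rintro ⟨r, s⟩ h
    simp at h ⊢
    tauto
  · rintro ⟨r, s⟩ h ⟨r', s'⟩ h'
    simp
  · rintro ⟨r, s⟩ h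
    simp at h
    refine ⟨(r, s), ?_, rfl⟩
    simp only [Finset.mem_filter, Finset.mem_product, Finset.mem_range]
    exact ⟨⟨⟨h.1, lt_of_lt_of_le h.2.1 (Finset.le_sup (f := lam) (by simpa using h.1))⟩, h.2.1⟩, h.2.2⟩

lemma glue_count_lt (k : ℕ) (lam mu : ℕ → ℕ) (T : ℕ → ℕ → ℕ) (h1 : ∀ r, mu r ≤ lam r)
    (hk : mu k = 0) (i : ℕ) (hi : i < k) :
    entryCount (k + 1) lam (glueT k lam mu T) i = entryCount k mu T i := by
  have : ∀ r, (Finset.range (lam r)).filter (fun s => glueT k lam mu T r s = i)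
      = (Finset.range (mu r)).filter (fun s => T r s = i) := by
    intro r
    ext s
    have := h1 r
    rw [Finset.mem_filter, Finset.mem_filter, Finset.mem_range, Finset.mem_range, glueT]
    split_ifs with h h' <;> omega
  rw [entryCount_eq, entryCount_eq, Finset.sum_range_succ]
  simp [this, hk]

lemma glue_count_eq (k : ℕ) (lam mu : ℕ → ℕ) (T : ℕ → ℕ → ℕ) (h1 : ∀ r, mu r ≤ lam r)
    (hT : IsSSYT k mu T) :
    entryCount (k + 1) lam (glueT k lam mu T) k = ∑ r ∈ Finset.range (k + 1), (lam r - mu r) := by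
  have : ∀ r, (Finset.range (lam r)).filter (fun s => glueT k lam mu T r s = k)
      = Finset.Ico (mu r) (lam r) := by
    intro r
    ext s
    have := h1 r
    have := hT.1 r s
    rw [Finset.mem_filter, Finset.mem_range, Finset.mem_Ico, glueT]
    split_ifs with h h' <;> omega
  rw [entryCount_eq]
  simp [this]

abbrev ILy (k : ℕ) (x : ℕ → ℕ) := {y : Fin k → ℕ //
  y ∈ Fintype.piFinset (fun j : Fin k => Finset.Icc (x j) (x (j + 1)))}

lemma il_bounds (k : ℕ) (x : ℕ → ℕ) (y : ILy k x) :
    (∀ r, revPart k (extz k y.1) r ≤ revPart (k + 1) x r) ∧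
    (∀ r, revPart (k + 1) x (r + 1) ≤ revPart k (extz k y.1) r) := by
  have h := fun j => Finset.mem_Icc.1 (Fintype.mem_piFinset.1 y.2 j)
  constructor
  · intro r
    unfold revPart extz
    by_cases hr : r < k
    · have := (h ⟨k - 1 - r, by omega⟩).2
      simp only [hr, if_true, show r < k + 1 by omega, show k - 1 - r < k by omega, dif_pos]
      refine this.trans (le_of_eq ?_)
      congr 1
      simp
      omega
    · simp [hr]
  · intro r
    unfold revPart extz
    by_cases hr : r < k
    · have := (h ⟨k - 1 - r, by omega⟩).1
      simp only [hr, if_true, show r + 1 < k + 1 by omega, show k - 1 - r < k by omega, dif_pos]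
      refine le_trans (le_of_eq ?_) this
      congr 1
      simp
      omega
    · simp [hr]

def glueMap (k : ℕ) (x : ℕ → ℕ) :
    (Σ y : ILy k x, {T // IsSSYT k (revPart k (extz k y.1)) T}) →
      {T // IsSSYT (k + 1) (revPart (k + 1) x) T} :=
  fun z => ⟨glueT k (revPart (k + 1) x) (revPart k (extz k z.1.1)) z.2.1,
    glue_ssyt _ _ _ _ (il_bounds k x z.1).1 (il_bounds k x z.1).2 z.2.2⟩

lemma revPart_inj (k : ℕ) (y y' : Fin k → ℕ)
    (h : revPart k (extz k y) = revPart k (extz k y')) : y = y' := by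
  ext j
  have h3 := congrFun h (k - 1 - j)
  have hj := j.2
  unfold revPart extz at h3
  simp only [show k - 1 - (j : ℕ) < k by omega, if_true,
    show k - 1 - (k - 1 - (j : ℕ)) = j by omega, hj, dif_pos] at h3
  exact h3

lemma revPart_anti (k : ℕ) (x : ℕ → ℕ) (hx : ∀ i, i + 1 < k → x i ≤ x (i + 1)) :
    Antitone (revPart k x) := by
  refine antitone_nat_of_succ_le fun r => ?_
  unfold revPart
  split_ifs with h h'
  · have := hx (k - 1 - (r + 1)) (by omega)
    rwa [show k - 1 - (r + 1) + 1 = k - 1 - r by omega] at this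
  · omega
  · omega
  · omega

lemma glueMap_bij (k : ℕ) (x : ℕ → ℕ) (hx : ∀ j, j < k → x j ≤ x (j + 1)) :
    Function.Bijective (glueMap k x) := by
  constructor
  · rintro ⟨y, T, hT⟩ ⟨y', T', hT'⟩ h
    have h' := congrArg Subtype.val h
    simp only [glueMap] at h'
    obtain ⟨h1, h2⟩ := glue_inj_mu _ _ _ _ _ _ (il_bounds k x y).1 (il_bounds k x y').1 hT hT' h'
    have h3 : y = y' := Subtype.ext (revPart_inj k _ _ h1)
    subst h3
    subst h2
    rfl
  · rintro ⟨T, hT⟩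
    obtain ⟨mu, T', h1, h2, h3, h4, h5⟩ := glue_surj k (revPart (k + 1) x)
      (revPart_anti _ _ (fun i hi => hx i (by omega))) T hT
    have hy : revPart k (extz k (fun j => mu (k - 1 - j))) = mu := by
      ext r
      unfold revPart extz
      by_cases hr : r < k
      · simp only [hr, if_true, show k - 1 - r < k by omega, dif_pos]
        congr 1; omega
      · simp [hr, h3 r (by omega)]
    refine ⟨⟨⟨fun j => mu (k - 1 - j), ?_⟩, ⟨T', ?_⟩⟩, ?_⟩
    · rw [Fintype.mem_piFinset]
      intro j
      have hj := j.2
      have h6 := h1 (k - 1 - j)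
      have h7 := h2 (k - 1 - j)
      unfold revPart at h6 h7
      rw [if_pos (by omega)] at h6 h7
      rw [Finset.mem_Icc]
      rw [show k + 1 - 1 - (k - 1 - (j : ℕ)) = j + 1 by omega] at h6
      rw [show k + 1 - 1 - (k - 1 - (j : ℕ) + 1) = j by omega] at h7
      exact ⟨h7, h6⟩
    · rw [hy]; exact h4
    · apply Subtype.ext
      simp only [glueMap]
      rw [hy, h5]

lemma extz_mono (k : ℕ) (x : ℕ → ℕ) (y : ILy (k + 1) x) (j : ℕ) (hj : j < k) :
    extz (k + 1) y.1 j ≤ extz (k + 1) y.1 (j + 1) := by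
  have h := fun j => Finset.mem_Icc.1 (Fintype.mem_piFinset.1 y.2 j)
  have h1 := (h ⟨j, by omega⟩).2
  have h2 := (h ⟨j + 1, by omega⟩).1
  unfold extz
  simp only [show j < k + 1 by omega, show j + 1 < k + 1 by omega, dif_pos]
  exact h1.trans h2

lemma extz_mono' (k : ℕ) (x : ℕ → ℕ) (y : ILy k x) (j : ℕ) (hj : j + 1 < k) :
    extz k y.1 j ≤ extz k y.1 (j + 1) := by
  cases k with
  | zero => omega
  | succ k => exact extz_mono k x y j (by omega)

lemma ssyt_finite (k : ℕ) : ∀ (x : ℕ → ℕ), (∀ i, i + 1 < k → x i ≤ x (i + 1)) →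
    Finite {T // IsSSYT k (revPart k x) T} := by
  induction k with
  | zero =>
    intro x _
    have : Subsingleton {T // IsSSYT 0 (revPart 0 x) T} := by
      constructor
      rintro ⟨T, hT⟩ ⟨T', hT'⟩
      apply Subtype.ext
      ext r c
      simp only
      rw [hT.2.1 r c (by simp [revPart]), hT'.2.1 r c (by simp [revPart])]
    infer_instance
  | succ k ih =>
    intro x hx
    have : ∀ y : ILy k x, Finite {T // IsSSYT k (revPart k (extz k y.1)) T} :=
      fun y => ih _ (extz_mono' k x y)
    exact Finite.of_surjective _ (glueMap_bij k x (fun j hj => hx j (by omega))).2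

lemma schur_succ (k : ℕ) (p : ℕ → ℝ) (x : ℕ → ℕ) (hx : ∀ j, j < k → x j ≤ x (j + 1)) :
    schur (k + 1) (revPart (k + 1) x) p =
      ∑ y ∈ Fintype.piFinset (fun j : Fin k => Finset.Icc (x j) (x (j + 1))),
        (p k ^ (x 0) * ∏ j : Fin k, p k ^ (x (j + 1) - y j)) *
          schur k (revPart k (extz k y)) p := by
  have hf : ∀ y : ILy k x, Finite {T // IsSSYT k (revPart k (extz k y.1)) T} :=
      fun y => ssyt_finite _ _ (extz_mono' k x y)
  have hft : ∀ y : ILy k x, Fintype {T // IsSSYT k (revPart k (extz k y.1)) T} :=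
    fun y => Fintype.ofFinite _
  rw [← Finset.sum_coe_sort]
  unfold schur
  rw [← (Equiv.ofBijective _ (glueMap_bij k x hx)).tsum_eq, tsum_fintype, Fintype.sum_sigma]
  refine Finset.sum_congr rfl fun y _ => ?_
  rw [tsum_fintype, Finset.mul_sum]
  refine Finset.sum_congr rfl fun T _ => ?_
  simp only [Equiv.ofBijective_apply, glueMap]
  have hb := il_bounds k x y
  rw [Finset.prod_range_succ, glue_count_eq _ _ _ _ hb.1 T.2, mul_comm]
  congr 1
  · rw [Finset.prod_pow_eq_pow_sum, ← pow_add]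
    congr 1
    rw [Finset.sum_range_succ, ← Finset.sum_range_reflect, add_comm, ← Fin.sum_univ_eq_sum_range
      (fun j => revPart (k + 1) x (k - 1 - j) - revPart k (extz k y.1) (k - 1 - j))]
    congr 1
    · simp [revPart]
    · refine Finset.sum_congr rfl fun j _ => ?_
      have hj := j.2
      unfold revPart extz
      rw [if_pos (by omega), if_pos (by omega), dif_pos (by omega)]
      have e1 : k + 1 - 1 - (k - 1 - (j : ℕ)) = j + 1 := by omega
      have e2 : (⟨k - 1 - (k - 1 - (j : ℕ)), by omega⟩ : Fin k) = j := by
        ext; simp only; omega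
      rw [e1, e2]
  · refine Finset.prod_congr rfl fun i hi => ?_
    rw [glue_count_lt _ _ _ _ hb.1 (by simp [revPart]) i (by simpa using hi)]

theorem schur_bialternant (k : ℕ) (p : ℕ → ℝ) : ∀ (x : ℕ → ℕ),
    (∀ i, i + 1 < k → x i ≤ x (i + 1)) →
    altS k p x = (∏ j ∈ Finset.range k, ∏ i ∈ Finset.range j, (p j - p i)) *
      schur k (revPart k x) p := by
  induction k with
  | zero =>
    intro x _
    have hz : IsSSYT 0 (revPart 0 x) (fun _ _ => 0) := by
      refine ⟨?_, ?_, ?_, ?_⟩ <;> simp [revPart]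
    have : Unique {T // IsSSYT 0 (revPart 0 x) T} :=
      { default := ⟨_, hz⟩
        uniq := by
          rintro ⟨T, hT⟩
          apply Subtype.ext
          ext r c
          exact hT.2.1 r c (by simp [revPart]) }
    unfold schur altS
    rw [tsum_fintype]
    simp
  | succ k ih =>
    intro x hx
    have hx' : ∀ j, j < k → x j ≤ x (j + 1) := fun j hj => hx j (by omega)
    rw [altS_succ k p x hx', schur_succ k p x hx', Finset.prod_range_succ,
      Fin.prod_univ_eq_prod_range (fun i => p k - p i), Finset.mul_sum, Finset.mul_sum]
    refine Finset.sum_congr rfl fun y hy => ?_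
    rw [ih _ (extz_mono' k x ⟨y, hy⟩)]
    ring

noncomputable def tm (k : ℕ) (p : ℕ → ℝ) (σ : Equiv.Perm (Fin k)) (z : ℕ → ℕ) : ℝ :=
  Real.exp (∑ i : Fin k, ((z i : ℝ) + (i : ℕ)) * (Real.log (p (σ i)) - Real.log (p i)))

noncomputable def Dh (k : ℕ) (p : ℕ → ℝ) (z : ℕ → ℕ) : ℝ :=
  ∑ σ : Equiv.Perm (Fin k), ((Equiv.Perm.sign σ : ℤ) : ℝ) * tm k p σ z

lemma Dh_eq (k : ℕ) (p : ℕ → ℝ) (hp0 : ∀ i, i < k → 0 < p i) (z : ℕ → ℕ) :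
    Dh k p z = (∏ i : Fin k, (p i)⁻¹ ^ (z i + i)) * altS k p z := by
  unfold Dh altS
  rw [Matrix.det_apply', Finset.mul_sum]
  refine Finset.sum_congr rfl fun σ _ => ?_
  rw [mul_left_comm]
  congr 1
  rw [tm, Real.exp_sum, ← Finset.prod_mul_distrib]
  refine Finset.prod_congr rfl fun i _ => ?_
  have h1 := hp0 i i.2
  have h2 := hp0 (σ i) (σ i).2
  have : ((z i : ℝ) + (i : ℕ)) * (Real.log (p (σ i)) - Real.log (p i))
    = ((z i + i : ℕ) : ℝ) * Real.log ((p i)⁻¹ * p (σ i)) := by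
    rw [Real.log_mul (by positivity) (by positivity), Real.log_inv]; push_cast; ring
  rw [this, Real.exp_nat_mul, Real.exp_log (by positivity), mul_pow]
  simp

def stp (z : ℕ → ℕ) (m : ℕ) : ℕ → ℕ := fun i => z i + if m = i then 1 else 0

def inW (k : ℕ) (z : ℕ → ℕ) : Prop := ∀ i, i + 1 < k → z i ≤ z (i + 1)

lemma tm_stp (k : ℕ) (p : ℕ → ℝ) (hp0 : ∀ i, i < k → 0 < p i) (σ : Equiv.Perm (Fin k))
    (z : ℕ → ℕ) (m : Fin k) : p m * tm k p σ (stp z m) = tm k p σ z * p (σ m) := by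
  have h1 := hp0 m m.2
  have h2 := hp0 (σ m) (σ m).2
  have : ∑ i : Fin k, ((stp z m i : ℝ) + (i : ℕ)) * (Real.log (p (σ i)) - Real.log (p i))
      = ∑ i : Fin k, ((z i : ℝ) + (i : ℕ)) * (Real.log (p (σ i)) - Real.log (p i))
        + (Real.log (p (σ m)) - Real.log (p m)) := by
    have h3 : (Real.log (p (σ m)) - Real.log (p m)) =
        ∑ i : Fin k, if m = i then (Real.log (p (σ i)) - Real.log (p i)) else 0 := by simp
    rw [h3, ← Finset.sum_add_distrib]
    refine Finset.sum_congr rfl fun i _ => ?_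
    unfold stp
    by_cases h : m = i
    · simp [h]; ring
    · have : (m : ℕ) ≠ i := fun h' => h (Fin.ext h')
      simp [h, this]
  unfold tm
  rw [this, Real.exp_add, Real.exp_sub, Real.exp_log h1, Real.exp_log h2]
  field_simp

lemma Dh_harm (k : ℕ) (p : ℕ → ℝ) (hp0 : ∀ i, i < k → 0 < p i)
    (hsum : ∑ i ∈ Finset.range k, p i = 1) (z : ℕ → ℕ) :
    ∑ m ∈ Finset.range k, p m * Dh k p (stp z m) = Dh k p z := by
  rw [← Fin.sum_univ_eq_sum_range (fun m => p m * Dh k p (stp z m))]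
  unfold Dh
  simp_rw [Finset.mul_sum]
  rw [Finset.sum_comm]
  refine Finset.sum_congr rfl fun σ _ => ?_
  have h1 : ∀ i : Fin k, p i * (((Equiv.Perm.sign σ : ℤ) : ℝ) * tm k p σ (stp z i))
      = ((Equiv.Perm.sign σ : ℤ) : ℝ) * (tm k p σ z * p (σ i)) := by
    intro i
    rw [mul_left_comm, tm_stp k p hp0 σ z]
  rw [Finset.sum_congr rfl (fun i _ => h1 i), ← Finset.mul_sum, ← Finset.mul_sum, Equiv.sum_comp σ (fun i : Fin k => p i),
    Fin.sum_univ_eq_sum_range, hsum, mul_one]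

lemma Dh_zero (k : ℕ) (p : ℕ → ℝ) (hp0 : ∀ i, i < k → 0 < p i) (z : ℕ → ℕ) (i : ℕ)
    (hi : i + 1 < k) (h : z i = z (i + 1) + 1) : Dh k p z = 0 := by
  rw [Dh_eq k p hp0, altS]
  rw [Matrix.det_zero_of_column_eq (i := ⟨i, by omega⟩) (j := ⟨i + 1, hi⟩), mul_zero]
  · simp
  · intro r
    simp only [Matrix.of_apply, h]
    congr 1
    omega

lemma Dh_exit (k : ℕ) (p : ℕ → ℝ) (hp0 : ∀ i, i < k → 0 < p i) (z : ℕ → ℕ) (m : ℕ)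
    (h : inW k z) (h' : ¬ inW k (stp z m)) : Dh k p (stp z m) = 0 := by
  unfold inW at h'
  push Not at h'
  obtain ⟨i, hi, hlt⟩ := h'
  refine Dh_zero k p hp0 _ i hi ?_
  have := h i hi
  unfold stp at *
  split_ifs at * <;> omega

lemma inW_mono {k : ℕ} {z : ℕ → ℕ} (h : inW k z) (i j : ℕ) (hij : i ≤ j) (hj : j < k) :
    z i ≤ z j := by
  induction j, hij using Nat.le_induction with
  | base => exact le_rfl
  | succ n hn ih => exact (ih (by omega)).trans (h n hj)

lemma tm_le (k : ℕ) (p : ℕ → ℝ) (hp0 : ∀ i, i < k → 0 < p i)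
    (hmono : ∀ i j, i < j → j < k → p i < p j) (z : ℕ → ℕ) (h : inW k z)
    (σ : Equiv.Perm (Fin k)) : tm k p σ z ≤ 1 := by
  unfold tm
  rw [Real.exp_le_one_iff]
  simp_rw [mul_sub]
  rw [Finset.sum_sub_distrib, sub_nonpos]
  refine Monovary.sum_mul_comp_perm_le_sum_mul (σ := σ)
    (f := fun i : Fin k => ((z i : ℝ) + (i : ℕ))) (g := fun i : Fin k => Real.log (p i)) ?_
  intro i j hij
  have hij' : (i : ℕ) ≤ j := by
    by_contra hc
    push Not at hc
    have h1 := hmono j i hc i.2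
    have h2 := Real.log_lt_log (hp0 j j.2) h1
    exact lt_asymm hij h2
  have h3 := inW_mono h i j hij' j.2
  simp only
  have h4 : (z i : ℝ) ≤ z j := by exact_mod_cast h3
  have h5 : ((i : ℕ) : ℝ) ≤ (j : ℕ) := by exact_mod_cast hij'
  linarith

lemma Dh_bound (k : ℕ) (p : ℕ → ℝ) (hp0 : ∀ i, i < k → 0 < p i)
    (hmono : ∀ i j, i < j → j < k → p i < p j) (z : ℕ → ℕ) (h : inW k z) :
    |Dh k p z| ≤ Fintype.card (Equiv.Perm (Fin k)) := by
  unfold Dh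
  refine (Finset.abs_sum_le_sum_abs _ _).trans ?_
  refine (Finset.sum_le_sum (g := fun _ => (1 : ℝ)) fun σ _ => ?_).trans (by simp)
  rw [abs_mul]
  have h1 : |((Equiv.Perm.sign σ : ℤ) : ℝ)| = 1 := by
    rw [← Int.cast_abs, Equiv.Perm.sign_abs]; simp
  rw [h1, one_mul, abs_of_pos (by unfold tm; positivity)]
  exact tm_le k p hp0 hmono z h σ

lemma strict_aux (k : ℕ) (p : ℕ → ℝ) (hp0 : ∀ i, i < k → 0 < p i)
    (hmono : ∀ i j, i < j → j < k → p i < p j) (σ : Equiv.Perm (Fin k)) (hσ : σ ≠ 1) :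
    ∑ i : Fin k, p i * (Real.log (p (σ i)) - Real.log (p i)) < 0 := by
  simp_rw [mul_sub]
  rw [Finset.sum_sub_distrib, sub_neg]
  have hlt : ∀ i j : Fin k, i < j → p i < p j := fun i j hij => hmono i j hij j.2
  have hiff : ∀ i j : Fin k, Real.log (p i) < Real.log (p j) ↔ i < j := by
    intro i j
    rw [Real.log_lt_log_iff (hp0 i i.2) (hp0 j j.2)]
    constructor
    · intro h
      by_contra hc
      rcases eq_or_lt_of_le (not_lt.1 hc) with h' | h'
      · rw [h'] at h; exact lt_irrefl _ h
      · exact lt_asymm h (hlt _ _ h')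
    · exact hlt i j
  refine (Monovary.sum_mul_comp_perm_lt_sum_mul_iff (σ := σ)
    (f := fun i : Fin k => p i) (g := fun i : Fin k => Real.log (p i)) ?_).2 ?_
  · intro i j hij
    exact (hlt _ _ ((hiff i j).1 hij)).le
  · intro hm
    apply hσ
    have hs : StrictMono (σ.symm : Fin k → Fin k) := by
      intro a b hab
      have h1 : p (σ.symm a) ≤ p (σ.symm b) := by
        refine @hm (σ.symm a) (σ.symm b) ?_
        simpa using (hiff a b).2 hab
      by_contra hc
      rcases eq_or_lt_of_le (not_lt.1 hc) with h' | h'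
      · exact hab.ne (σ.symm.injective h').symm
      · exact absurd (hlt _ _ h') (not_lt.2 h1)
    have h2 : (σ.symm : Fin k → Fin k) = id :=
      (StrictMono.range_inj hs strictMono_id).1 (by simp)
    ext i
    have h3 := congrFun h2 (σ i)
    simp at h3
    simp [← h3]

open Filter Topology in
lemma Dh_tendsto (k : ℕ) (p : ℕ → ℝ) (hp0 : ∀ i, i < k → 0 < p i)
    (hmono : ∀ i j, i < j → j < k → p i < p j) (z : ℕ → ℕ → ℕ)
    (hz : ∀ i, i < k → Tendsto (fun n => (z n i : ℝ) / n) atTop (𝓝 (p i))) :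
    Tendsto (fun n => Dh k p (z n)) atTop (𝓝 1) := by
  have h1 : (1 : ℝ) = ∑ σ : Equiv.Perm (Fin k), ((Equiv.Perm.sign σ : ℤ) : ℝ) *
      (if σ = 1 then 1 else 0) := by simp
  rw [h1]
  unfold Dh
  refine tendsto_finsetSum _ fun σ _ => Tendsto.const_mul _ ?_
  by_cases hσ : σ = 1
  · subst hσ
    simp [tm]
  · rw [if_neg hσ]
    unfold tm
    refine Real.tendsto_exp_atBot.comp ?_
    have hc := strict_aux k p hp0 hmono σ hσ
    have h2 : Tendsto (fun n : ℕ => ∑ i : Fin k, ((z n i : ℝ) / n + ((i : ℕ) : ℝ) / n) *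
        (Real.log (p (σ i)) - Real.log (p i))) atTop
        (𝓝 (∑ i : Fin k, p i * (Real.log (p (σ i)) - Real.log (p i)))) := by
      refine tendsto_finsetSum _ fun i _ => Tendsto.mul_const _ ?_
      have := (hz i i.2).add (tendsto_const_div_atTop_nhds_zero_nat ((i : ℕ) : ℝ))
      simpa using this
    have h3 := h2.neg_mul_atTop hc tendsto_natCast_atTop_atTop
    refine h3.congr' ?_
    filter_upwards [eventually_gt_atTop 0] with n hn
    have : (n : ℝ) ≠ 0 := by positivity
    rw [Finset.sum_mul]
    refine Finset.sum_congr rfl fun i _ => ?_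
    field_simp

def Zw (a : ℕ → ℕ) (x : ℕ → ℕ) (n : ℕ) : ℕ → ℕ :=
  fun i => x i + ((Finset.range n).filter (fun m => a m = i)).card

lemma Zw_succ (a x : ℕ → ℕ) (n : ℕ) : Zw a x (n + 1) = stp (Zw a x n) (a n) := by
  ext i
  unfold Zw stp
  rw [Finset.range_add_one, Finset.filter_insert]
  split_ifs with h
  · rw [Finset.card_insert_of_notMem (by simp), add_assoc]
  · simp

lemma Zw_congr (a b x : ℕ → ℕ) (n m : ℕ) (h : ∀ m < n, a m = b m) (hm : m ≤ n) :
    Zw a x m = Zw b x m := by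
  ext i
  unfold Zw
  congr 2
  refine Finset.filter_congr fun j hj => ?_
  rw [h j (by simp at hj; omega)]

def St (k : ℕ) (x a : ℕ → ℕ) (n : ℕ) : Prop := ∀ m ≤ n, inW k (Zw a x m)

lemma St_congr (k : ℕ) (a b x : ℕ → ℕ) (n : ℕ) (h : ∀ m < n, a m = b m) :
    St k x a n = St k x b n := by
  unfold St
  refine forall_congr fun m => forall_congr fun hm => ?_
  rw [Zw_congr a b x n m h hm]

lemma St_succ (k : ℕ) (a x : ℕ → ℕ) (n : ℕ) :
    St k x a (n + 1) ↔ St k x a n ∧ inW k (Zw a x (n + 1)) := by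
  unfold St
  constructor
  · intro h
    exact ⟨fun m hm => h m (by omega), h _ le_rfl⟩
  · rintro ⟨h1, h2⟩ m hm
    rcases Nat.lt_or_ge n m with h | h
    · have : m = n + 1 := by omega
      rw [this]; exact h2
    · exact h1 m h

open Classical in
noncomputable def Gf (k : ℕ) (p : ℕ → ℝ) (x : ℕ → ℕ) (n : ℕ) (a : ℕ → ℕ) : ℝ :=
  if St k x a n then Dh k p (Zw a x n) else 0

open Classical in
noncomputable def Pf (k : ℕ) (p : ℕ → ℝ) (x : ℕ → ℕ) (n i : ℕ) (a : ℕ → ℕ) : ℝ :=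
  if St k x a n then Dh k p (stp (Zw a x n) i) else 0

lemma Gf_succ (k : ℕ) (p : ℕ → ℝ) (hp0 : ∀ i, i < k → 0 < p i) (x : ℕ → ℕ) (n : ℕ) (a : ℕ → ℕ) :
    Gf k p x (n + 1) a = Pf k p x n (a n) a := by
  unfold Gf Pf
  rw [← Zw_succ]
  by_cases h : St k x a n
  · by_cases h' : inW k (Zw a x (n + 1))
    · rw [if_pos ((St_succ k a x n).2 ⟨h, h'⟩), if_pos h]
    · rw [if_neg (fun h2 => h' ((St_succ k a x n).1 h2).2), if_pos h]
      rw [Zw_succ] at h' ⊢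
      exact (Dh_exit k p hp0 _ _ (h n le_rfl) h').symm
  · rw [if_neg (fun h2 => h ((St_succ k a x n).1 h2).1), if_neg h]

lemma Pf_bound (k : ℕ) (p : ℕ → ℝ) (hp0 : ∀ i, i < k → 0 < p i)
    (hmono : ∀ i j, i < j → j < k → p i < p j) (x : ℕ → ℕ) (n i : ℕ) (a : ℕ → ℕ) :
    |Pf k p x n i a| ≤ Fintype.card (Equiv.Perm (Fin k)) := by
  unfold Pf
  split_ifs with h
  · by_cases h' : inW k (stp (Zw a x n) i)
    · exact Dh_bound k p hp0 hmono _ h'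
    · rw [Dh_exit k p hp0 _ _ (h n le_rfl) h']
      simp
  · simp

lemma Gf_bound (k : ℕ) (p : ℕ → ℝ) (hp0 : ∀ i, i < k → 0 < p i)
    (hmono : ∀ i j, i < j → j < k → p i < p j) (x : ℕ → ℕ) (n : ℕ) (a : ℕ → ℕ) :
    |Gf k p x n a| ≤ Fintype.card (Equiv.Perm (Fin k)) := by
  unfold Gf
  split_ifs with h
  · exact Dh_bound k p hp0 hmono _ (h n le_rfl)
  · simp

lemma Pf_sum (k : ℕ) (p : ℕ → ℝ) (hp0 : ∀ i, i < k → 0 < p i)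
    (hsum : ∑ i ∈ Finset.range k, p i = 1) (x : ℕ → ℕ) (n : ℕ) (a : ℕ → ℕ) :
    ∑ i ∈ Finset.range k, p i * Pf k p x n i a = Gf k p x n a := by
  unfold Gf Pf
  split_ifs with h
  · exact Dh_harm k p hp0 hsum _
  · simp

section prob
variable {Ω : Type*} [MeasureSpace Ω]

def extR (n : ℕ) (t : Finset.range n → ℕ) : ℕ → ℕ :=
  fun m => if h : m ∈ Finset.range n then t ⟨m, h⟩ else 0

lemma dep_eq {α : Type*} (ξ : ℕ → Ω → ℕ) (n : ℕ) (Φ : (ℕ → ℕ) → α)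
    (hΦ : ∀ a b : ℕ → ℕ, (∀ m < n, a m = b m) → Φ a = Φ b) (ω : Ω) :
    Φ (fun m => ξ m ω) = Φ (extR n (fun i => ξ i ω)) := by
  apply hΦ
  intro m hm
  simp [extR, hm]

lemma dep_meas (ξ : ℕ → Ω → ℕ) (hmeas : ∀ m, Measurable (ξ m)) (n : ℕ) (Φ : (ℕ → ℕ) → ℝ)
    (hΦ : ∀ a b : ℕ → ℕ, (∀ m < n, a m = b m) → Φ a = Φ b) :
    Measurable (fun ω => Φ (fun m => ξ m ω)) := by
  simp_rw [dep_eq ξ n Φ hΦ]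
  have h1 : Measurable (fun ω => (fun i : Finset.range n => ξ i ω)) :=
    measurable_pi_lambda _ fun i => hmeas i
  have h2 : Measurable (fun t : Finset.range n → ℕ => Φ (extR n t)) := Measurable.of_discrete
  exact h2.comp h1

lemma dep_int [IsProbabilityMeasure (ℙ : Measure Ω)] (ξ : ℕ → Ω → ℕ)
    (hmeas : ∀ m, Measurable (ξ m)) (hindep : iIndepFun ξ ℙ)
    (n i : ℕ) (q : ℝ) (hq : 0 ≤ q) (hlaw : ℙ {ω | ξ n ω = i} = ENNReal.ofReal q)
    (Φ : (ℕ → ℕ) → ℝ)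
    (hΦ : ∀ a b : ℕ → ℕ, (∀ m < n, a m = b m) → Φ a = Φ b) :
    ∫ ω, (if ξ n ω = i then (1 : ℝ) else 0) * Φ (fun m => ξ m ω)
      = q * ∫ ω, Φ (fun m => ξ m ω) := by
  have hI := hindep.indepFun_finset (Finset.range n) {n} (by simp) hmeas
  have h2 : Measurable (fun t : Finset.range n → ℕ => Φ (extR n t)) := Measurable.of_discrete
  have h3 : Measurable (fun t : ({n} : Finset ℕ) → ℕ =>
    if t ⟨n, by simp⟩ = i then (1 : ℝ) else 0) := Measurable.of_discrete
  have hJ := (hI.comp h2 h3).symm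
  have h4 : Measurable (fun ω => if ξ n ω = i then (1 : ℝ) else 0) :=
    (Measurable.of_discrete (f := fun m : ℕ => if m = i then (1 : ℝ) else 0)).comp (hmeas n)
  have h5 := dep_meas ξ hmeas n Φ hΦ
  have hK : IndepFun (fun ω => if ξ n ω = i then (1 : ℝ) else 0)
      (fun ω => Φ (fun m => ξ m ω)) ℙ := by
    have e : (fun ω => Φ (fun m => ξ m ω)) = (fun t : Finset.range n → ℕ => Φ (extR n t)) ∘
      (fun ω => (fun i : Finset.range n => ξ i ω)) := by
      ext ω; exact dep_eq ξ n Φ hΦ ω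
    rw [e]
    exact hJ
  rw [hK.integral_fun_mul_eq_mul_integral h4.aestronglyMeasurable h5.aestronglyMeasurable]
  congr 1
  have h6 : MeasurableSet {ω | ξ n ω = i} := hmeas n (measurableSet_singleton i)
  have h7 : (fun ω => if ξ n ω = i then (1 : ℝ) else 0) =
      Set.indicator {ω | ξ n ω = i} 1 := by
    ext ω; simp [Set.indicator]
  rw [h7, integral_indicator_one h6, measureReal_def, hlaw, ENNReal.toReal_ofReal hq]

lemma ae_lt [IsProbabilityMeasure (ℙ : Measure Ω)] (k : ℕ) (p : ℕ → ℝ)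
    (hp0 : ∀ i, i < k → 0 < p i) (hsum : ∑ i ∈ Finset.range k, p i = 1)
    (ξ : ℕ → Ω → ℕ) (hmeas : ∀ m, Measurable (ξ m))
    (hlaw : ∀ m i, i < k → ℙ {ω | ξ m ω = i} = ENNReal.ofReal (p i)) (m : ℕ) :
    ∀ᵐ ω, ξ m ω < k := by
  have h1 : {ω | ξ m ω < k} = ⋃ i ∈ Finset.range k, {ω | ξ m ω = i} := by
    ext ω; simp
  have hM : ∀ i, MeasurableSet {ω | ξ m ω = i} := fun i => hmeas m (measurableSet_singleton i)
  have h2 : ℙ {ω | ξ m ω < k} = 1 := by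
    rw [h1, measure_biUnion_finset _ (fun i _ => hM i)]
    · rw [Finset.sum_congr rfl (fun i hi => hlaw m i (by simpa using hi)),
        ← ENNReal.ofReal_sum_of_nonneg (fun i hi => (hp0 i (by simpa using hi)).le), hsum]
      simp
    · intro i _ j _ hij
      refine Set.disjoint_left.2 fun ω h h' => hij ?_
      simp at h h'
      omega
  refine (mem_ae_iff_prob_eq_one ?_).2 h2
  exact hmeas m (measurableSet_Iio (a := k))

lemma Gf_dep (k : ℕ) (p : ℕ → ℝ) (x : ℕ → ℕ) (n : ℕ) (a b : ℕ → ℕ) (h : ∀ m < n, a m = b m) :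
    Gf k p x n a = Gf k p x n b := by
  unfold Gf
  have h1 := St_congr k a b x n h
  rw [Zw_congr a b x n n h le_rfl]
  by_cases h2 : St k x b n
  · rw [if_pos h2, if_pos (h1 ▸ h2)]
  · rw [if_neg h2, if_neg (h1 ▸ h2)]

lemma Pf_dep (k : ℕ) (p : ℕ → ℝ) (x : ℕ → ℕ) (n i : ℕ) (a b : ℕ → ℕ) (h : ∀ m < n, a m = b m) :
    Pf k p x n i a = Pf k p x n i b := by
  unfold Pf
  have h1 := St_congr k a b x n h
  rw [Zw_congr a b x n n h le_rfl]
  by_cases h2 : St k x b n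
  · rw [if_pos h2, if_pos (h1 ▸ h2)]
  · rw [if_neg h2, if_neg (h1 ▸ h2)]

lemma int_Gf [IsProbabilityMeasure (ℙ : Measure Ω)] (k : ℕ) (p : ℕ → ℝ)
    (hp0 : ∀ i, i < k → 0 < p i)
    (hmono : ∀ i j, i < j → j < k → p i < p j) (hsum : ∑ i ∈ Finset.range k, p i = 1)
    (ξ : ℕ → Ω → ℕ) (hmeas : ∀ m, Measurable (ξ m)) (hindep : iIndepFun ξ ℙ)
    (hlaw : ∀ m i, i < k → ℙ {ω | ξ m ω = i} = ENNReal.ofReal (p i))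
    (x : ℕ → ℕ) (hx : inW k x) (n : ℕ) :
    ∫ ω, Gf k p x n (fun m => ξ m ω) = Dh k p x := by
  induction n with
  | zero =>
    have h0 : ∀ a, Zw a x 0 = x := fun a => by ext i; simp [Zw]
    have : ∀ a, Gf k p x 0 a = Dh k p x := by
      intro a
      unfold Gf
      rw [h0, if_pos]
      intro m hm
      rw [Nat.le_zero.1 hm, h0]; exact hx
    simp [this]
  | succ n ih =>
    rw [← ih]
    have hPm := fun i => dep_meas ξ hmeas n (Pf k p x n i) (Pf_dep k p x n i)
    have hPi : ∀ i, Integrable (fun ω => Pf k p x n i (fun m => ξ m ω)) ℙ := fun i =>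
      Integrable.of_bound (hPm i).aestronglyMeasurable _
        (ae_of_all _ fun ω => by
          rw [Real.norm_eq_abs]; exact Pf_bound k p hp0 hmono x n i _)
    have h4 : ∀ i, Measurable (fun ω => if ξ n ω = i then (1 : ℝ) else 0) := fun i =>
      (Measurable.of_discrete (f := fun m : ℕ => if m = i then (1 : ℝ) else 0)).comp (hmeas n)
    have h5 : ∀ i, Integrable (fun ω => (if ξ n ω = i then (1 : ℝ) else 0) *
        Pf k p x n i (fun m => ξ m ω)) ℙ := fun i =>
      (hPi i).bdd_mul (c := 1) (h4 i).aestronglyMeasurable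
        (ae_of_all _ fun ω => by split_ifs <;> simp)
    have h1 : (fun ω => Gf k p x (n + 1) (fun m => ξ m ω)) =ᵐ[ℙ]
        fun ω => ∑ i ∈ Finset.range k, (if ξ n ω = i then (1 : ℝ) else 0) *
          Pf k p x n i (fun m => ξ m ω) := by
      filter_upwards [ae_lt k p hp0 hsum ξ hmeas hlaw n] with ω hω
      rw [Gf_succ k p hp0]
      simp [hω]
    rw [integral_congr_ae h1, integral_finsetSum _ (fun i _ => h5 i)]
    rw [Finset.sum_congr rfl (fun i hi => dep_int ξ hmeas hindep n i (p i)
      (hp0 i (by simpa using hi)).le (hlaw n i (by simpa using hi)) _ (Pf_dep k p x n i))]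
    simp_rw [← integral_const_mul]
    rw [← integral_finsetSum _ (fun i _ => (hPi i).const_mul _)]
    simp_rw [Pf_sum k p hp0 hsum]

open Filter Topology in
lemma slln [IsProbabilityMeasure (ℙ : Measure Ω)] (k : ℕ) (p : ℕ → ℝ)
    (hp0 : ∀ i, i < k → 0 < p i) (hsum : ∑ i ∈ Finset.range k, p i = 1)
    (ξ : ℕ → Ω → ℕ) (hmeas : ∀ m, Measurable (ξ m)) (hindep : iIndepFun ξ ℙ)
    (hlaw : ∀ m i, i < k → ℙ {ω | ξ m ω = i} = ENNReal.ofReal (p i)) (x : ℕ → ℕ)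
    (i : ℕ) (hi : i < k) :
    ∀ᵐ ω, Tendsto (fun n => (Zw (fun m => ξ m ω) x n i : ℝ) / n) atTop (𝓝 (p i)) := by
  have hf : Measurable (fun m : ℕ => if m = i then (1 : ℝ) else 0) := Measurable.of_discrete
  have hid : ∀ m, IdentDistrib (ξ m) (ξ 0) ℙ ℙ := by
    intro m
    refine ⟨(hmeas m).aemeasurable, (hmeas 0).aemeasurable, ?_⟩
    refine Measure.ext_of_singleton fun j => ?_
    rw [Measure.map_apply (hmeas m) (measurableSet_singleton j),
      Measure.map_apply (hmeas 0) (measurableSet_singleton j)]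
    change ℙ {ω | ξ m ω = j} = ℙ {ω | ξ 0 ω = j}
    by_cases hj : j < k
    · rw [hlaw m j hj, hlaw 0 j hj]
    · have hz : ∀ m, ℙ {ω | ξ m ω = j} = 0 := by
        intro m
        have := ae_lt k p hp0 hsum ξ hmeas hlaw m
        refine measure_mono_null ?_ (ae_iff.1 this)
        intro ω hω
        simp at hω ⊢
        omega
      rw [hz, hz]
  have h4 : ∀ m, Measurable (fun ω => if ξ m ω = i then (1 : ℝ) else 0) := fun m =>
      hf.comp (hmeas m)
  have := strong_law_ae_real (μ := (ℙ : Measure Ω))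
    (fun m ω => if ξ m ω = i then (1 : ℝ) else 0)
    (Integrable.of_bound (h4 0).aestronglyMeasurable 1
      (ae_of_all _ fun ω => by split_ifs <;> simp))
    (fun a b hab => (hindep.indepFun hab).comp hf hf)
    (fun m => (hid m).comp hf)
  have h6 : MeasurableSet {ω | ξ 0 ω = i} := hmeas 0 (measurableSet_singleton i)
  have h7 : (fun ω => if ξ 0 ω = i then (1 : ℝ) else 0) =
      Set.indicator {ω | ξ 0 ω = i} 1 := by
    ext ω; simp [Set.indicator]
  rw [h7, integral_indicator_one h6, measureReal_def, hlaw 0 i hi,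
    ENNReal.toReal_ofReal (hp0 i hi).le] at this
  filter_upwards [this] with ω hω
  have h8 := (tendsto_const_div_atTop_nhds_zero_nat ((x i : ℕ) : ℝ)).add hω
  rw [zero_add] at h8
  refine h8.congr fun n => ?_
  rw [Finset.sum_boole]
  simp [Zw, add_div]

open Filter Topology in
lemma prob_eq [IsProbabilityMeasure (ℙ : Measure Ω)] (k : ℕ) (p : ℕ → ℝ)
    (hp0 : ∀ i, i < k → 0 < p i)
    (hmono : ∀ i j, i < j → j < k → p i < p j) (hsum : ∑ i ∈ Finset.range k, p i = 1)
    (ξ : ℕ → Ω → ℕ) (hmeas : ∀ m, Measurable (ξ m)) (hindep : iIndepFun ξ ℙ)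
    (hlaw : ∀ m i, i < k → ℙ {ω | ξ m ω = i} = ENNReal.ofReal (p i))
    (x : ℕ → ℕ) (hx : inW k x) :
    ℙ {ω | ∀ n, inW k (Zw (fun m => ξ m ω) x n)} = ENNReal.ofReal (Dh k p x) := by
  classical
  set S := {ω | ∀ n, inW k (Zw (fun m => ξ m ω) x n)} with hS
  have hSm : MeasurableSet S := by
    have : S = ⋂ n, (fun ω => (fun a : ℕ → ℕ => if St k x a n then (1 : ℝ) else 0)
        (fun m => ξ m ω)) ⁻¹' {1} := by
      ext ω
      simp only [hS, Set.mem_ofPred_eq, Set.mem_iInter, Set.mem_preimage, Set.mem_singleton_iff]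
      constructor
      · intro h n
        rw [if_pos (show St k x (fun m => ξ m ω) n from fun m _ => h m)]
      · intro h n
        have h1 := h n
        by_cases h2 : St k x (fun m => ξ m ω) n
        · exact h2 n le_rfl
        · rw [if_neg h2] at h1; norm_num at h1
    rw [this]
    refine MeasurableSet.iInter fun n => ?_
    refine dep_meas ξ hmeas n (fun a : ℕ → ℕ => if St k x a n then (1 : ℝ) else 0) ?_
      (measurableSet_singleton _)
    intro a b hab
    have h1 := St_congr k a b x n hab
    by_cases h2 : St k x b n
    · simp only [if_pos h2, if_pos (h1 ▸ h2 : St k x a n)]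
    · simp only [if_neg h2, if_neg (h1 ▸ h2 : ¬ St k x a n)]
  have hlim : Tendsto (fun n => ∫ ω, Gf k p x n (fun m => ξ m ω)) atTop
      (𝓝 (∫ ω, S.indicator (1 : Ω → ℝ) ω)) := by
    refine tendsto_integral_of_dominated_convergence
      (fun _ => (Fintype.card (Equiv.Perm (Fin k)) : ℝ)) ?_ (integrable_const _) ?_ ?_
    · exact fun n => (dep_meas ξ hmeas n _ (Gf_dep k p x n)).aestronglyMeasurable
    · exact fun n => ae_of_all _ fun ω => by
        rw [Real.norm_eq_abs]; exact Gf_bound k p hp0 hmono x n _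
    · have hs : ∀ᵐ ω, ∀ i, i < k →
          Tendsto (fun n => (Zw (fun m => ξ m ω) x n i : ℝ) / n) atTop (𝓝 (p i)) := by
        rw [ae_all_iff]
        intro i
        by_cases hi : i < k
        · filter_upwards [slln k p hp0 hsum ξ hmeas hindep hlaw x i hi] with ω hω _ using hω
        · exact ae_of_all _ fun ω h => absurd h hi
      filter_upwards [hs] with ω hω
      by_cases hSω : ω ∈ S
      · rw [Set.indicator_of_mem hSω]
        refine (Dh_tendsto k p hp0 hmono _ hω).congr fun n => ?_
        unfold Gf
        rw [if_pos (show St k x (fun m => ξ m ω) n from fun m _ => hSω m)]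
      · rw [Set.indicator_of_notMem hSω]
        simp only [hS, Set.mem_ofPred_eq, not_forall] at hSω
        obtain ⟨N, hN⟩ := hSω
        refine tendsto_const_nhds.congr' ?_
        filter_upwards [eventually_ge_atTop N] with n hn
        unfold Gf
        rw [if_neg (fun h => hN (h N hn))]
  simp_rw [int_Gf k p hp0 hmono hsum ξ hmeas hindep hlaw x hx] at hlim
  rw [integral_indicator_one hSm] at hlim
  rw [tendsto_nhds_unique tendsto_const_nhds hlim, measureReal_def,
    ENNReal.ofReal_toReal (measure_ne_top _ _)]

end prob

/-- if `0 < p_1 < ⋯ < p_k`, there is a constant `C > 0` such that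
for every starting point `x ∈ W ∩ ℤ_+^k`, the probability that the walk started
at `x` stays in the Weyl chamber forever equals `C · p^{-x} · s_{x^*}(p)`. -/
theorem stmt10 {Ω : Type*} [MeasureSpace Ω] [IsProbabilityMeasure (ℙ : Measure Ω)]
    (k : ℕ) (hk : 2 ≤ k) (p : ℕ → ℝ)
    (hp0 : ∀ i, i < k → 0 < p i)
    (hmono : ∀ i j, i < j → j < k → p i < p j)
    (hsum : ∑ i ∈ Finset.range k, p i = 1)
    (ξ : ℕ → Ω → ℕ) (hmeas : ∀ m, Measurable (ξ m))
    (hindep : iIndepFun ξ ℙ)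
    (hlaw : ∀ m i, i < k → ℙ {ω | ξ m ω = i} = ENNReal.ofReal (p i)) :
    ∃ C : ℝ, 0 < C ∧ ∀ x : ℕ → ℕ, (∀ i, i + 1 < k → x i ≤ x (i+1)) →
      ℙ {ω | ∀ n, ∀ i, i + 1 < k →
          (x i : ℤ) + Xcnt ξ i n ω ≤ (x (i+1) : ℤ) + Xcnt ξ (i+1) n ω}
        = ENNReal.ofReal
            (C * (∏ i ∈ Finset.range k, (p i)⁻¹ ^ x i) * schur k (revPart k x) p) := by
  refine ⟨(∏ i ∈ Finset.range k, (p i)⁻¹ ^ i) *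
    ∏ j ∈ Finset.range k, ∏ i ∈ Finset.range j, (p j - p i), ?_, ?_⟩
  · refine mul_pos (Finset.prod_pos fun i hi => ?_)
      (Finset.prod_pos fun j hj => Finset.prod_pos fun i hi => ?_)
    · have := hp0 i (by simpa using hi)
      positivity
    · exact sub_pos.2 (hmono i j (by simpa using hi) (by simpa using hj))
  · intro x hx
    have h1 := prob_eq k p hp0 hmono hsum ξ hmeas hindep hlaw x hx
    have h2 : {ω | ∀ n, ∀ i, i + 1 < k →
          (x i : ℤ) + Xcnt ξ i n ω ≤ (x (i+1) : ℤ) + Xcnt ξ (i+1) n ω} =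
        {ω | ∀ n, inW k (Zw (fun m => ξ m ω) x n)} := by
      ext ω
      simp only [Set.mem_ofPred_eq, inW, Zw, Xcnt]
      refine forall_congr' fun n => forall_congr' fun i => forall_congr' fun _ => ?_
      norm_cast
    rw [h2, h1, Dh_eq k p hp0, schur_bialternant k p x hx,
      Fin.prod_univ_eq_prod_range (fun i => (p i)⁻¹ ^ (x i + i))]
    simp_rw [pow_add, Finset.prod_mul_distrib]
    congr 1
    ring
end
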